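/- Assume (B0)–(B3), fix ȳ ∈ cl V, let ũ be the modified potential with convex sub-level set Q := {ũ ≤ 0} ⊂ cl U_ȳ. Let 𝒦 ⊂ Q be an open convex set with diam(𝒦) ≤ ε_c/4 and 𝒦 ⊂ B ⊂ 4·B ⊂ U_ȳ for some ball B. After a translation, assume the John ellipsoid of 𝒦 is centered at the origin, and for ρ ∈ (0,1) let ρ·𝒦 denote the dilation of 𝒦 about the origin. Let ‖v‖*_𝒦 := sup_{w ∈ 𝒦} w·v be the dual norm associated to 𝒦. Then, with C*(n, ρ) := 8n/(1−ρ)², one has ‖−D_q c̃(q, y)‖*_𝒦 ≤ C*(n, ρ) |inf_𝒦 ũ| for all q ∈ ρ·𝒦 and all y ∈ ∂^{c̃}ũ(ρ·𝒦). -/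

import Mathlib

open Set MeasureTheory Metric Bornology
open scoped ENNReal NNReal Pointwise

noncomputable section

abbrev Euc (n : ℕ) := EuclideanSpace ℝ (Fin n)

/-- Partial gradient of the cost in the first variable: `D_x c(x,y)`. -/
noncomputable def gradX (n : ℕ) (c : Euc n → Euc n → ℝ) (x y : Euc n) : Euc n :=
  gradient (fun x' => c x' y) x

/-- Partial gradient of the cost in the second variable: `D_y c(x,y)`. -/
noncomputable def gradY (n : ℕ) (c : Euc n → Euc n → ℝ) (x y : Euc n) : Euc n :=
  gradient (fun y' => c x y') y

/-- Mixed second derivative `D²_{xy} c` as a continuous linear map. -/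
noncomputable def DxyC (n : ℕ) (c : Euc n → Euc n → ℝ) (x y : Euc n) : Euc n →L[ℝ] Euc n :=
  fderiv ℝ (fun x' => gradY n c x' y) x

/-- Second derivative `D²_{xx} c`. -/
noncomputable def DxxC (n : ℕ) (c : Euc n → Euc n → ℝ) (x y : Euc n) : Euc n →L[ℝ] Euc n :=
  fderiv ℝ (fun x' => gradX n c x' y) x

/-- Third derivative `D²_{xx} D_y c`. -/
noncomputable def DxxyC (n : ℕ) (c : Euc n → Euc n → ℝ) (x y : Euc n) :
    Euc n →L[ℝ] Euc n →L[ℝ] Euc n :=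
  fderiv ℝ (fun x' => DxyC n c x' y) x

/-- `β⁺_c = ‖D²_{xy} c‖_{L∞(U×V)}`. -/
noncomputable def betaPlus (n : ℕ) (c : Euc n → Euc n → ℝ) (U V : Set (Euc n)) : ℝ :=
  sSup ((fun p : Euc n × Euc n => ‖DxyC n c p.1 p.2‖) '' (U ×ˢ V))

/-- `β⁻_c = ‖(D²_{xy} c)⁻¹‖_{L∞(U×V)}`. -/
noncomputable def betaMinus (n : ℕ) (c : Euc n → Euc n → ℝ) (U V : Set (Euc n)) : ℝ :=
  sSup ((fun p : Euc n × Euc n => ‖(DxyC n c p.1 p.2).inverse‖) '' (U ×ˢ V))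

/-- `γ⁺_c = ‖det D²_{xy} c‖_{L∞(U×V)}`. -/
noncomputable def gammaPlus (n : ℕ) (c : Euc n → Euc n → ℝ) (U V : Set (Euc n)) : ℝ :=
  sSup ((fun p : Euc n × Euc n =>
    |LinearMap.det ((DxyC n c p.1 p.2 : Euc n →L[ℝ] Euc n) : Euc n →ₗ[ℝ] Euc n)|) '' (U ×ˢ V))

/-- `γ⁻_c = ‖(det D²_{xy} c)⁻¹‖_{L∞(U×V)}`. -/
noncomputable def gammaMinus (n : ℕ) (c : Euc n → Euc n → ℝ) (U V : Set (Euc n)) : ℝ :=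
  sSup ((fun p : Euc n × Euc n =>
    |LinearMap.det ((DxyC n c p.1 p.2 : Euc n →L[ℝ] Euc n) : Euc n →ₗ[ℝ] Euc n)|⁻¹) '' (U ×ˢ V))

noncomputable def supDxx (n : ℕ) (c : Euc n → Euc n → ℝ) (U V : Set (Euc n)) : ℝ :=
  sSup ((fun p : Euc n × Euc n => ‖DxxC n c p.1 p.2‖) '' (U ×ˢ V))

noncomputable def supDx (n : ℕ) (c : Euc n → Euc n → ℝ) (U V : Set (Euc n)) : ℝ :=
  sSup ((fun p : Euc n × Euc n => ‖gradX n c p.1 p.2‖) '' (U ×ˢ V))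

noncomputable def supDxxy (n : ℕ) (c : Euc n → Euc n → ℝ) (U V : Set (Euc n)) : ℝ :=
  sSup ((fun p : Euc n × Euc n => ‖DxxyC n c p.1 p.2‖) '' (U ×ˢ V))

/-- The constant `M_c` from Theorem 4.3. -/
noncomputable def Mconst (n : ℕ) (c : Euc n → Euc n → ℝ) (U V : Set (Euc n)) : ℝ :=
  (betaMinus n c U V) ^ 2 * supDxx n c U V +
    (betaMinus n c U V) ^ 3 * supDx n c U V * supDxxy n c U V

/-- The constant `ε_c` of Lemma 6.1: `1/ε_c = 2 (β⁺)⁴ (β⁻)⁶ ‖D³_{xxy} c‖_∞`. -/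
noncomputable def epsC (n : ℕ) (c : Euc n → Euc n → ℝ) (U V : Set (Euc n)) : ℝ :=
  (2 * (betaPlus n c U V) ^ 4 * (betaMinus n c U V) ^ 6 * supDxxy n c U V)⁻¹

/-- Condition (B0). -/
def B0cond (n : ℕ) (c : Euc n → Euc n → ℝ) (U V : Set (Euc n)) : Prop :=
  IsOpen U ∧ IsBounded U ∧ IsOpen V ∧ IsBounded V ∧
    ContDiffOn ℝ 4 (Function.uncurry c) (closure U ×ˢ closure V)

/-- `f` is a (C¹-) diffeomorphism from `S` onto its range. -/
def DiffeoOnto (n : ℕ) (f : Euc n → Euc n) (S : Set (Euc n)) : Prop :=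
  Set.InjOn f S ∧ ContDiffOn ℝ 1 f S ∧ ContDiffOn ℝ 1 (Function.invFunOn f S) (f '' S)

/-- Condition (B1) (bi-twist). -/
def B1cond (n : ℕ) (c : Euc n → Euc n → ℝ) (U V : Set (Euc n)) : Prop :=
  (∀ y ∈ closure V, DiffeoOnto n (fun x => -gradY n c x y) (closure U)) ∧
  (∀ x ∈ closure U, DiffeoOnto n (fun y => -gradX n c x y) (closure V))

/-- `U_ȳ := -D_y c(U, ȳ)`. -/
def Uyset (n : ℕ) (c : Euc n → Euc n → ℝ) (U : Set (Euc n)) (ybar : Euc n) : Set (Euc n) :=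
  (fun x => -gradY n c x ybar) '' U

/-- `V_x̄ := -D_x c(x̄, V)`. -/
def Vxset (n : ℕ) (c : Euc n → Euc n → ℝ) (V : Set (Euc n)) (xbar : Euc n) : Set (Euc n) :=
  (fun y => -gradX n c xbar y) '' V

/-- Condition (B2) (bi-convexity). -/
def B2cond (n : ℕ) (c : Euc n → Euc n → ℝ) (U V : Set (Euc n)) : Prop :=
  (∀ y ∈ closure V, Convex ℝ (Uyset n c U y)) ∧ (∀ x ∈ closure U, Convex ℝ (Vxset n c V x))

/-- A strongly convex set: each boundary point is touched from outside by a sphere of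
radius `R` enclosing the set. -/
def StronglyConvexSet (n : ℕ) (Q : Set (Euc n)) : Prop :=
  Convex ℝ Q ∧ ∃ R : ℝ, 0 < R ∧ ∀ x ∈ frontier Q, ∃ z : Euc n, dist x z = R ∧ Q ⊆ closedBall z R

/-- Condition (B2s). -/
def B2scond (n : ℕ) (c : Euc n → Euc n → ℝ) (U V : Set (Euc n)) : Prop :=
  (∀ y ∈ closure V, StronglyConvexSet n (Uyset n c U y)) ∧
  (∀ x ∈ closure U, StronglyConvexSet n (Vxset n c V x))

/-- An affinely parameterized line segment on `[-1,1]`. -/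
def IsAffineSeg (n : ℕ) (F : ℝ → Euc n × Euc n) : Prop :=
  ∃ a b : Euc n × Euc n, ∀ t ∈ Icc (-1 : ℝ) 1, F t = a + t • b

/-- `∂²/∂s∂t c(x(s), y(t))` at `(0,0)`. -/
noncomputable def crossDiff2 (n : ℕ) (c : Euc n → Euc n → ℝ) (x y : ℝ → Euc n) : ℝ :=
  deriv (fun s => deriv (fun t => c (x s) (y t)) 0) 0

/-- `∂⁴/∂s²∂t² c(x(s), y(t))` at `(0,0)`. -/
noncomputable def crossDiff4 (n : ℕ) (c : Euc n → Euc n → ℝ) (x y : ℝ → Euc n) : ℝ :=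
  deriv (deriv (fun s => deriv (deriv (fun t => c (x s) (y t))) 0)) 0

/-- Condition (B3) (= A3w). -/
def B3cond (n : ℕ) (c : Euc n → Euc n → ℝ) (U V : Set (Euc n)) : Prop :=
  ∀ x y : ℝ → Euc n, (∀ t ∈ Icc (-1 : ℝ) 1, x t ∈ closure U) →
    (∀ t ∈ Icc (-1 : ℝ) 1, y t ∈ closure V) →
    IsAffineSeg n (fun t => (gradY n c (x t) (y 0), gradX n c (x 0) (y t))) →
    crossDiff2 n c x y = 0 → crossDiff4 n c x y ≤ 0

/-- Condition (B4) (non-negative cross-curvature). -/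
def B4cond (n : ℕ) (c : Euc n → Euc n → ℝ) (U V : Set (Euc n)) : Prop :=
  ∀ x y : ℝ → Euc n, (∀ t ∈ Icc (-1 : ℝ) 1, x t ∈ closure U) →
    (∀ t ∈ Icc (-1 : ℝ) 1, y t ∈ closure V) →
    IsAffineSeg n (fun t => (gradY n c (x t) (y 0), gradX n c (x 0) (y t))) →
    crossDiff4 n c x y ≤ 0

/-- The `c*`-transform `u^{c*}(y) = sup_{x ∈ A} (-c(x,y) - u(x))`. -/
noncomputable def cStarT (n : ℕ) (c : Euc n → Euc n → ℝ) (A : Set (Euc n)) (u : Euc n → ℝ)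
    (y : Euc n) : ℝ :=
  sSup ((fun x => -c x y - u x) '' A)

/-- `u` is `c`-convex on `A` (relative to the target set `B`): `u = (u^{c*})^c`. -/
def CConvexOn (n : ℕ) (c : Euc n → Euc n → ℝ) (A B : Set (Euc n)) (u : Euc n → ℝ) : Prop :=
  ∀ x ∈ A, u x = sSup ((fun y => -c x y - cStarT n c A u y) '' B)

/-- The `c`-subdifferential `∂ᶜu ⊂ A × B`. -/
def cSubdiff (n : ℕ) (c : Euc n → Euc n → ℝ) (A B : Set (Euc n)) (u : Euc n → ℝ) :
    Set (Euc n × Euc n) :=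
  {p | p.1 ∈ A ∧ p.2 ∈ B ∧ u p.1 + cStarT n c A u p.2 + c p.1 p.2 = 0}

def cSubdiffAt (n : ℕ) (c : Euc n → Euc n → ℝ) (A B : Set (Euc n)) (u : Euc n → ℝ)
    (x : Euc n) : Set (Euc n) :=
  {y | (x, y) ∈ cSubdiff n c A B u}

def cSubdiffImg (n : ℕ) (c : Euc n → Euc n → ℝ) (A B : Set (Euc n)) (u : Euc n → ℝ)
    (X : Set (Euc n)) : Set (Euc n) :=
  ⋃ x ∈ X, cSubdiffAt n c A B u x

/-- `∂^{c*}u^{c*}(Y) = {x : ∃ y ∈ Y, (x,y) ∈ ∂ᶜu}`. -/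
def cSubdiffPre (n : ℕ) (c : Euc n → Euc n → ℝ) (A B : Set (Euc n)) (u : Euc n → ℝ)
    (Y : Set (Euc n)) : Set (Euc n) :=
  {x | ∃ y ∈ Y, (x, y) ∈ cSubdiff n c A B u}

/-- `|∂ᶜu| ≥ lam` on `S`. -/
def MAge (n : ℕ) (c : Euc n → Euc n → ℝ) (A B : Set (Euc n)) (u : Euc n → ℝ) (lam : ℝ)
    (S : Set (Euc n)) : Prop :=
  ∀ X : Set (Euc n), X ⊆ S → MeasurableSet X →
    ENNReal.ofReal lam * volume X ≤ volume (cSubdiffImg n c A B u X)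

/-- `|∂ᶜu| ≤ lam` on `S`. -/
def MAle (n : ℕ) (c : Euc n → Euc n → ℝ) (A B : Set (Euc n)) (u : Euc n → ℝ) (lam : ℝ)
    (S : Set (Euc n)) : Prop :=
  ∀ X : Set (Euc n), X ⊆ S → MeasurableSet X →
    volume (cSubdiffImg n c A B u X) ≤ ENNReal.ofReal lam * volume X

/-- The inverse of the cost-exponential coordinate change `q(x) = -D_y c(x, ȳ)`. -/
noncomputable def xOf (n : ℕ) (c : Euc n → Euc n → ℝ) (U : Set (Euc n)) (ybar : Euc n) :
    Euc n → Euc n :=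
  Function.invFunOn (fun x => -gradY n c x ybar) (closure U)

/-- `cl U_ȳ := -D_y c(cl U, ȳ)`. -/
def clUy (n : ℕ) (c : Euc n → Euc n → ℝ) (U : Set (Euc n)) (ybar : Euc n) : Set (Euc n) :=
  (fun x => -gradY n c x ybar) '' closure U

/-- The modified cost `c̃(q,y) = c(x(q), y) - c(x(q), ȳ)`. -/
noncomputable def modCost (n : ℕ) (c : Euc n → Euc n → ℝ) (U : Set (Euc n)) (ybar : Euc n)
    (q y : Euc n) : ℝ :=
  c (xOf n c U ybar q) y - c (xOf n c U ybar q) ybar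

/-- The modified potential `ũ(q) = u(x(q)) + c(x(q), ȳ)`. -/
noncomputable def modPot (n : ℕ) (c : Euc n → Euc n → ℝ) (U : Set (Euc n)) (ybar : Euc n)
    (u : Euc n → ℝ) (q : Euc n) : ℝ :=
  u (xOf n c U ybar q) + c (xOf n c U ybar q) ybar

/-- The `c̃`-cone generated by `qt` and `Q` with height `-h0 > 0`. -/
noncomputable def cConeFun (n : ℕ) (ct : Euc n → Euc n → ℝ) (B Q : Set (Euc n)) (qt : Euc n)
    (h0 : ℝ) (q : Euc n) : ℝ :=
  sSup {r : ℝ | ∃ y ∈ B, r = -ct q y + ct qt y + h0 ∧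
    ∀ p ∈ frontier Q, -ct p y + ct qt y + h0 ≤ 0}

/-- The ordinary subdifferential `∂u(x)` relative to a domain `A`. -/
def subdiffAt (n : ℕ) (A : Set (Euc n)) (u : Euc n → ℝ) (x : Euc n) : Set (Euc n) :=
  {p | ∀ ε > 0, ∃ δ > 0, ∀ x' ∈ A, ‖x' - x‖ < δ →
    u x + @inner ℝ _ _ p (x' - x) - ε * ‖x' - x‖ ≤ u x'}

/-- The dual norm `‖v‖*_K = sup_{w ∈ K} ⟨w, v⟩`. -/
noncomputable def dualNorm (n : ℕ) (K : Set (Euc n)) (v : Euc n) : ℝ :=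
  sSup ((fun w => (@inner ℝ _ _ w v : ℝ)) '' K)

/-- The section `S(x̄, ȳ, τ)`. -/
def sectS (n : ℕ) (c : Euc n → Euc n → ℝ) (U : Set (Euc n)) (u : Euc n → ℝ)
    (xbar ybar : Euc n) (τ : ℝ) : Set (Euc n) :=
  {x ∈ U | u x ≤ u xbar - c x ybar + c xbar ybar + τ}

/-- The measure with density `f` restricted to `A`. -/
noncomputable def densMeasure (n : ℕ) (A : Set (Euc n)) (f : Euc n → ℝ) : Measure (Euc n) :=
  (volume.restrict A).withDensity fun x => ENNReal.ofReal (f x)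

end

/-- Directional derivative. -/
noncomputable def ddir {E : Type*} [NormedAddCommGroup E] [NormedSpace ℝ E]
    (v : E) (f : E → ℝ) (z : E) : ℝ := fderiv ℝ f z v

section DD
variable {E : Type*} [NormedAddCommGroup E] [NormedSpace ℝ E]

lemma ddir_contDiffAt {f : E → ℝ} {z : E} {k m : ℕ} (hf : ContDiffAt ℝ k f z) (hm : m + 1 ≤ k)
    (v : E) : ContDiffAt ℝ m (ddir v f) z := by
  have h1 : ContDiffAt ℝ m (fderiv ℝ f) z := hf.fderiv_right (by exact_mod_cast hm)
  exact h1.clm_apply contDiffAt_const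

lemma ddir_comm {f : E → ℝ} {z : E} (hf : ContDiffAt ℝ (2 : ℕ) f z) (a b : E) :
    ddir a (ddir b f) z = ddir b (ddir a f) z := by
  have hs : IsSymmSndFDerivAt ℝ f z := by
    apply hf.isSymmSndFDerivAt
    simp
  have hd : DifferentiableAt ℝ (fderiv ℝ f) z := by
    have h1 : ContDiffAt ℝ (1 : ℕ) (fderiv ℝ f) z := hf.fderiv_right (by norm_num)
    exact h1.differentiableAt (by norm_num)
  have key : ∀ u v : E, ddir u (ddir v f) z = fderiv ℝ (fderiv ℝ f) z u v := by
    intro u v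
    unfold ddir
    have := (hd.hasFDerivAt.clm_apply (hasFDerivAt_const v z)).fderiv
    rw [this]; simp
  rw [key, key]; exact hs a b

lemma ddir_congr {f g : E → ℝ} {z : E} (h : f =ᶠ[nhds z] g) (v : E) :
    ddir v f =ᶠ[nhds z] ddir v g := by
  filter_upwards [h.fderiv (𝕜 := ℝ)] with w hw
  unfold ddir; rw [hw]

lemma ddir_comm_ev {f : E → ℝ} {z : E} {k : ℕ} (hf : ContDiffAt ℝ k f z) (hk : 2 ≤ k) (a b : E) :
    ddir a (ddir b f) =ᶠ[nhds z] ddir b (ddir a f) := by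
  filter_upwards [hf.eventually (by simp)] with w hw
  exact ddir_comm (hw.of_le (by exact_mod_cast hk)) a b

lemma ddir_comm3 {f : E → ℝ} {z : E} (hf : ContDiffAt ℝ (3 : ℕ) f z) (a b : E) :
    ddir a (ddir b (ddir b f)) z = ddir b (ddir b (ddir a f)) z := by
  rw [ddir_comm (ddir_contDiffAt hf (by norm_num) b)]
  exact (ddir_congr (ddir_comm_ev hf (by norm_num) a b) b).eq_of_nhds

lemma ddir_comm4 {f : E → ℝ} {z : E} (hf : ContDiffAt ℝ (4 : ℕ) f z) (a b : E) :
    ddir a (ddir a (ddir b (ddir b f))) z = ddir b (ddir b (ddir a (ddir a f))) z := by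
  have h3 : ddir a (ddir b (ddir b f)) =ᶠ[nhds z] ddir b (ddir b (ddir a f)) := by
    filter_upwards [hf.eventually (by simp)] with w hw
    exact ddir_comm3 (hw.of_le (by norm_num)) a b
  rw [(ddir_congr h3 a).eq_of_nhds]
  exact ddir_comm3 (ddir_contDiffAt hf (by norm_num) a) a b

/-- first derivative along a curve -/
lemma deriv_along {f : E → ℝ} {α : ℝ → E} {t : ℝ} (hf : DifferentiableAt ℝ f (α t))
    (hα : DifferentiableAt ℝ α t) :
    HasDerivAt (fun s => f (α s)) (ddir (deriv α t) f (α t)) t :=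
  hf.hasFDerivAt.comp_hasDerivAt t hα.hasDerivAt

/-- second derivative along a curve -/
lemma deriv2_along {f : E → ℝ} {α : ℝ → E} {t : ℝ} (hf : ContDiffAt ℝ (2 : ℕ) f (α t))
    (hα : ContDiffAt ℝ (2 : ℕ) α t) :
    HasDerivAt (deriv (fun s => f (α s)))
      (ddir (deriv α t) (ddir (deriv α t) f) (α t) + ddir (deriv (deriv α) t) f (α t)) t := by
  have hev : deriv (fun s => f (α s)) =ᶠ[nhds t] fun s => fderiv ℝ f (α s) (deriv α s) := by
    have h1 := hα.eventually (by simp)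
    have h2 := hα.continuousAt.eventually (hf.eventually (by simp))
    filter_upwards [h1, h2] with s hs1 hs2
    exact (deriv_along (hs2.differentiableAt (by norm_num))
      (hs1.differentiableAt (by norm_num))).deriv
  refine HasDerivAt.congr_of_eventuallyEq ?_ hev
  have hd : DifferentiableAt ℝ (fderiv ℝ f) (α t) := by
    have h1 : ContDiffAt ℝ (1 : ℕ) (fderiv ℝ f) (α t) := hf.fderiv_right (by norm_num)
    exact h1.differentiableAt (by norm_num)
  have hda : DifferentiableAt ℝ (deriv α) t := by
    have h1 : ContDiffAt ℝ (1 : ℕ) (deriv α) t := by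
      have h2 : ContDiffAt ℝ (1 : ℕ) (fderiv ℝ α) t := hα.fderiv_right (by norm_num)
      have : deriv α = fun s => fderiv ℝ α s 1 := by ext1 s; simp
      rw [this]
      exact h2.clm_apply contDiffAt_const
    exact h1.differentiableAt (by norm_num)
  have hαd := (hα.differentiableAt (by norm_num)).hasDerivAt
  have h1 : HasDerivAt (fun s => fderiv ℝ f (α s)) (fderiv ℝ (fderiv ℝ f) (α t) (deriv α t)) t :=
    hd.hasFDerivAt.comp_hasDerivAt t hαd
  have h2 := h1.clm_apply hda.hasDerivAt
  convert h2 using 2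
  have h3 := (hd.hasFDerivAt.clm_apply (hasFDerivAt_const (deriv α t) (α t))).fderiv
  · unfold ddir
    rw [h3]; simp
  · rfl

end DD

section INV
open Filter Topology
variable {E : Type*} [NormedAddCommGroup E] [NormedSpace ℝ E] [FiniteDimensional ℝ E]

/-- Local structure of an injective map with differentiable inverse. -/
lemma inv_fderiv {f : E → E} {S : Set E} {y : E} (hinj : Set.InjOn f S)
    (hg : ContDiffOn ℝ 1 (Function.invFunOn f S) (f '' S)) (hyS : S ∈ 𝓝 y)
    (hf : DifferentiableAt ℝ f y) :
    ∃ e : E ≃L[ℝ] E, (e : E →L[ℝ] E) = fderiv ℝ f y := by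
  have hy : y ∈ S := mem_of_mem_nhds hyS
  have hgd : DifferentiableWithinAt ℝ (Function.invFunOn f S) (f '' S) (f y) :=
    (hg (f y) (mem_image_of_mem f hy)).differentiableWithinAt (by norm_num)
  have hcomp := hgd.hasFDerivWithinAt.comp y hf.hasFDerivAt.hasFDerivWithinAt (mapsTo_image f S)
  have hid : HasFDerivAt (fun z => z)
      ((fderivWithin ℝ (Function.invFunOn f S) (f '' S) (f y)).comp (fderiv ℝ f y)) y := by
    refine (hcomp.hasFDerivAt hyS).congr_of_eventuallyEq ?_
    filter_upwards [hyS] with z hz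
    exact (hinj.leftInvOn_invFunOn hz).symm
  have heq := hid.unique (hasFDerivAt_id y)
  have hinj' : Function.Injective (fderiv ℝ f y : E →ₗ[ℝ] E) := by
    intro a b hab
    have ha := DFunLike.congr_fun heq a
    have hb := DFunLike.congr_fun heq b
    simp only [ContinuousLinearMap.comp_apply, ContinuousLinearMap.id_apply] at ha hb
    have hab' : fderiv ℝ f y a = fderiv ℝ f y b := hab
    rw [← ha, ← hb, hab']
  refine ⟨(LinearEquiv.ofInjectiveEndo _ hinj').toContinuousLinearEquiv, ?_⟩
  ext v
  rfl

lemma inv_nhds {f : E → E} {S : Set E} {y : E} (hinj : Set.InjOn f S)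
    (hg : ContDiffOn ℝ 1 (Function.invFunOn f S) (f '' S)) (hyS : S ∈ 𝓝 y)
    {k : ℕ} (hk : 1 ≤ k) (hf : ContDiffAt ℝ k f y) :
    ContDiffAt ℝ k (Function.invFunOn f S) (f y) ∧ 𝓝 (f y) = Filter.map f (𝓝 y) := by
  have hk0 : (k : WithTop ℕ∞) ≠ 0 := by
    exact_mod_cast (by omega : k ≠ 0)
  obtain ⟨e, he⟩ := inv_fderiv hinj hg hyS (hf.differentiableAt hk0)
  have hfd : HasFDerivAt f (e : E →L[ℝ] E) y := by
    rw [he]; exact (hf.differentiableAt hk0).hasFDerivAt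
  have hstrict : HasStrictFDerivAt f (e : E →L[ℝ] E) y := hf.hasStrictFDerivAt' hfd hk0
  refine ⟨?_, hstrict.map_nhds_eq_of_equiv.symm⟩
  have hloc := hf.to_localInverse hfd hk0
  refine hloc.congr_of_eventuallyEq ?_
  have hr := hstrict.eventually_right_inverse
  have hc : ∀ᶠ p in 𝓝 (f y), hstrict.localInverse f e y p ∈ S :=
    hstrict.localInverse_tendsto.eventually hyS
  filter_upwards [hr, hc] with p hp1 hp2
  have : Function.invFunOn f S (f (hstrict.localInverse f e y p)) = hstrict.localInverse f e y p :=
    hinj.leftInvOn_invFunOn hp2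
  rw [hp1] at this
  exact this

/-- Unique differentiability transferred from a convex image. -/
lemma inv_uniqueDiff {f : E → E} {V S : Set E} {y : E} (hVS : V ⊆ S) (hinj : Set.InjOn f S)
    (hf : ContDiffOn ℝ 1 f S)
    (hg : ContDiffOn ℝ 1 (Function.invFunOn f S) (f '' S)) (hy : y ∈ S) (hyV : y ∈ closure V)
    (hconv : Convex ℝ (f '' V)) (hIntr : (interior (f '' V)).Nonempty) :
    UniqueDiffWithinAt ℝ S y := by
  set g := Function.invFunOn f S with hgdef
  have hgf : ∀ z ∈ S, g (f z) = z := fun z hz => hinj.leftInvOn_invFunOn hz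
  have hfy : f y ∈ closure (f '' V) :=
    ((hf.continuousOn y hy).mono hVS).mem_closure_image hyV
  have hu : UniqueDiffWithinAt ℝ (f '' V) (f y) := uniqueDiffWithinAt_convex hconv hIntr hfy
  have hgd : HasFDerivWithinAt g (fderivWithin ℝ g (f '' S) (f y)) (f '' S) (f y) :=
    ((hg (f y) (mem_image_of_mem f hy)).differentiableWithinAt (by norm_num)).hasFDerivWithinAt
  have hgd' := hgd.mono (image_mono hVS)
  have hfd : HasFDerivWithinAt f (fderivWithin ℝ f S y) S (g (f y)) := by
    rw [hgf y hy]
    exact ((hf y hy).differentiableWithinAt (by norm_num)).hasFDerivWithinAt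
  have hmaps : MapsTo g (f '' V) S := by
    rintro _ ⟨z, hz, rfl⟩
    rw [hgf z (hVS hz)]; exact hVS hz
  have hcomp := hfd.comp (f y) hgd' hmaps
  have hid : HasFDerivWithinAt (fun p => p)
      ((fderivWithin ℝ f S y).comp (fderivWithin ℝ g (f '' S) (f y))) (f '' V) (f y) := by
    refine hcomp.congr ?_ ?_
    · rintro _ ⟨z, hz, rfl⟩
      simp [hgf z (hVS hz)]
    · simp [hgf y hy]
  have heq := hu.eq hid (hasFDerivWithinAt_id (f y) (f '' V))
  have hinj' : Function.Injective (fderivWithin ℝ g (f '' S) (f y) : E →ₗ[ℝ] E) := by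
    intro a b hab
    have ha := DFunLike.congr_fun heq a
    have hb := DFunLike.congr_fun heq b
    simp only [ContinuousLinearMap.comp_apply, ContinuousLinearMap.id_apply] at ha hb
    have hab' : fderivWithin ℝ g (f '' S) (f y) a = fderivWithin ℝ g (f '' S) (f y) b := hab
    rw [← ha, ← hb, hab']
  have hsurj : Function.Surjective (fderivWithin ℝ g (f '' S) (f y) : E →ₗ[ℝ] E) :=
    LinearMap.surjective_of_injective hinj'
  have h := hgd'.uniqueDiffWithinAt hu (Function.Surjective.denseRange hsurj)
  rw [hgf y hy] at h
  refine h.mono ?_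
  rintro _ ⟨_, ⟨z, hz, rfl⟩, rfl⟩
  rw [hgf z (hVS hz)]; exact hVS hz

end INV

section QC
variable {E : Type*} [NormedAddCommGroup E] [InnerProductSpace ℝ E] [CompleteSpace E]

/-- Quasi-convexity from the Hessian condition. -/
lemma quasi_of_hess {O : Set E} (hOc : Convex ℝ O) {m : E → ℝ}
    (hm : ∀ q ∈ O, ContDiffAt ℝ (2 : ℕ) m q) (hne : ∀ q ∈ O, fderiv ℝ m q ≠ 0)
    (hH : ∀ q ∈ O, ∀ e, ddir e m q = 0 → 0 ≤ ddir e (ddir e m) q)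
    {p w : E} (hp : p ∈ O) (hw : w ∈ O) (hpos : 0 < ddir (w - p) m p) : m p ≤ m w := by
  set e := w - p with he
  set γ : ℝ → E := fun s => p + s • e with hγ
  have hγO : ∀ s ∈ Icc (0:ℝ) 1, γ s ∈ O := by
    intro s hs
    have := hOc.add_smul_sub_mem hp hw hs
    simpa [hγ, he] using this
  have hγd : ∀ s, HasDerivAt γ e s := by
    intro s
    have := ((hasDerivAt_id s).smul_const e).const_add p
    simpa [hγ] using this
  have hγc : Continuous γ := by fun_prop
  have hsnd : ∀ q ∈ O, ∀ a b, ddir a (ddir b m) q = fderiv ℝ (fderiv ℝ m) q a b := by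
    intro q hq u v
    have hd : DifferentiableAt ℝ (fderiv ℝ m) q := by
      have h1 : ContDiffAt ℝ (1 : ℕ) (fderiv ℝ m) q := (hm q hq).fderiv_right (by norm_num)
      exact h1.differentiableAt (by norm_num)
    unfold ddir
    have := (hd.hasFDerivAt.clm_apply (hasFDerivAt_const v q)).fderiv
    rw [this]; simp
  have hf1 : ∀ s ∈ Icc (0:ℝ) 1, HasDerivAt (fun s => m (γ s)) (ddir e m (γ s)) s := by
    intro s hs
    have h := deriv_along (((hm _ (hγO s hs)).differentiableAt (by norm_num)))
      (hγd s).differentiableAt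
    rwa [(hγd s).deriv] at h
  have hf2 : ∀ s ∈ Icc (0:ℝ) 1, HasDerivAt (fun s => ddir e m (γ s))
      (fderiv ℝ (fderiv ℝ m) (γ s) e e) s := by
    intro s hs
    have h := deriv_along (f := ddir e m) ((ddir_contDiffAt (m := 1)
      (hm _ (hγO s hs)) (by norm_num) e).differentiableAt (by norm_num))
      (hγd s).differentiableAt
    rw [(hγd s).deriv, hsnd _ (hγO s hs)] at h
    exact h
  -- bounds
  have hcf1 : ContinuousOn (fun s => ‖fderiv ℝ m (γ s)‖) (Icc (0:ℝ) 1) := by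
    intro s hs
    have h1 : ContDiffAt ℝ (1 : ℕ) (fderiv ℝ m) (γ s) :=
      (hm _ (hγO s hs)).fderiv_right (by norm_num)
    exact (h1.continuousAt.comp hγc.continuousAt).norm.continuousWithinAt
  have hcf2 : ContinuousOn (fun s => ‖fderiv ℝ (fderiv ℝ m) (γ s)‖) (Icc (0:ℝ) 1) := by
    intro s hs
    have h1 : ContDiffAt ℝ (1 : ℕ) (fderiv ℝ m) (γ s) :=
      (hm _ (hγO s hs)).fderiv_right (by norm_num)
    have h2 : ContDiffAt ℝ (0 : ℕ) (fderiv ℝ (fderiv ℝ m)) (γ s) :=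
      h1.fderiv_right (by norm_num)
    have h3 := (h2.continuousAt.comp (x := s) hγc.continuousAt)
    have h4 : ContinuousAt (fun s => ‖fderiv ℝ (fderiv ℝ m) (γ s)‖) s :=
      (continuous_norm (E := E →L[ℝ] E →L[ℝ] ℝ)).continuousAt.comp h3
    exact h4.continuousWithinAt
  obtain ⟨s0, hs0, hmin⟩ := isCompact_Icc.exists_isMinOn (nonempty_Icc.2 zero_le_one) hcf1
  obtain ⟨s1, hs1, hmax⟩ := isCompact_Icc.exists_isMaxOn (nonempty_Icc.2 zero_le_one) hcf2
  set g0 := ‖fderiv ℝ m (γ s0)‖ with hg0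
  set M := ‖fderiv ℝ (fderiv ℝ m) (γ s1)‖ with hM
  have hg0pos : 0 < g0 := norm_pos_iff.2 (hne _ (hγO s0 hs0))
  have hM0 : 0 ≤ M := norm_nonneg (fderiv ℝ (fderiv ℝ m) (γ s1))
  set C := 2 * M * ‖e‖ / g0 with hC
  have hkey : ∀ s ∈ Icc (0:ℝ) 1,
      -(C * |ddir e m (γ s)|) ≤ fderiv ℝ (fderiv ℝ m) (γ s) e e := by
    intro s hs
    set q := γ s
    have hq : q ∈ O := hγO s hs
    set g : E := (InnerProductSpace.toDual ℝ E).symm (fderiv ℝ m q) with hg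
    have hgi : ∀ v, fderiv ℝ m q v = inner ℝ g v := by
      intro v; rw [hg, InnerProductSpace.toDual_symm_apply]
    have hgn : ‖g‖ = ‖fderiv ℝ m q‖ := by rw [hg]; simp
    have hgpos : 0 < ‖g‖ := by rw [hgn]; exact norm_pos_iff.2 (hne q hq)
    have hgge : g0 ≤ ‖g‖ := by rw [hgn]; exact hmin hs
    set δ := ddir e m q with hδ
    have hδ' : δ = inner ℝ g e := hgi e
    set k : E := (δ / ‖g‖ ^ 2) • g with hk
    set a := e - k with ha
    have hkn : ‖k‖ = |δ| / ‖g‖ := by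
      rw [hk, norm_smul, Real.norm_eq_abs, abs_div, abs_of_nonneg (sq_nonneg ‖g‖)]
      field_simp
    have ha0 : ddir a m q = 0 := by
      change fderiv ℝ m q a = 0
      rw [hgi, ha, inner_sub_right, ← hδ', hk, inner_smul_right, real_inner_self_eq_norm_sq]
      field_simp; simp
    have han : ‖a‖ ≤ ‖e‖ := by
      have h1 : inner ℝ a k = 0 := by
        rw [hk, inner_smul_right]
        have : inner ℝ g a = 0 := by rw [← hgi]; exact ha0
        rw [real_inner_comm, this, mul_zero]
      have h2 : ‖e‖ ^ 2 = ‖a‖ ^ 2 + ‖k‖ ^ 2 := by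
        have : e = a + k := by simp [ha]
        rw [this, norm_add_sq_real, h1]; ring
      have := sq_nonneg ‖k‖
      exact le_of_sq_le_sq (by linarith) (norm_nonneg e)
    have hH2 := hH q hq a ha0
    rw [hsnd q hq] at hH2
    set B := fderiv ℝ (fderiv ℝ m) q with hB
    have hBM : ‖B‖ ≤ M := hmax hs
    have hdec : B e e = B a a + B a k + B k e := by
      have : e = a + k := by simp [ha]
      have h1 : B e e = B a e + B k e := by
        conv_lhs => rw [show B e = B a + B k by rw [← map_add, ← this]]
        simp
      have h2 : B a e = B a a + B a k := by rw [← map_add, ← this]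
      rw [h1, h2]
    have hb1 : |B a k| ≤ M * ‖e‖ * ‖k‖ := by
      calc |B a k| ≤ ‖B‖ * ‖a‖ * ‖k‖ := B.le_opNorm₂ a k
        _ ≤ M * ‖e‖ * ‖k‖ := by gcongr
    have hb2 : |B k e| ≤ M * ‖k‖ * ‖e‖ := by
      calc |B k e| ≤ ‖B‖ * ‖k‖ * ‖e‖ := B.le_opNorm₂ k e
        _ ≤ M * ‖k‖ * ‖e‖ := by gcongr
    have hkle : ‖k‖ ≤ |δ| / g0 := by
      rw [hkn]; gcongr
    have hfin : 2 * M * ‖e‖ * ‖k‖ ≤ C * |δ| := by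
      calc 2 * M * ‖e‖ * ‖k‖ ≤ 2 * M * ‖e‖ * (|δ| / g0) := by gcongr
        _ = C * |δ| := by rw [hC]; ring
    have := neg_le_of_abs_le hb1
    have := neg_le_of_abs_le hb2
    rw [hdec]; linarith
  have hC0 : 0 ≤ C := by positivity
  set β := ddir e m p with hβ
  have hγ0 : γ 0 = p := by simp [hγ]
  have hγ1 : γ 1 = w := by simp [hγ, he]
  have hfence : ∀ ⦃s⦄, s ∈ Icc (0:ℝ) 1 →
      -ddir e m (γ s) ≤ -(β * Real.exp (-(C + 1) * s)) := by
    refine image_le_of_deriv_right_lt_deriv_boundary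
      (f := fun s => -ddir e m (γ s)) (f' := fun s => -fderiv ℝ (fderiv ℝ m) (γ s) e e)
      (B := fun s => -(β * Real.exp (-(C + 1) * s)))
      (B' := fun s => -(β * (Real.exp (-(C + 1) * s) * (-(C + 1))))) ?_ ?_ ?_ ?_ ?_
    · intro s hs
      exact (hf2 s hs).neg.continuousAt.continuousWithinAt
    · intro s hs
      exact (hf2 s (Ico_subset_Icc_self hs)).neg.hasDerivWithinAt
    · simp [hγ0, hβ]
    · intro s
      have h1 : HasDerivAt (fun s : ℝ => -(C + 1) * s) (-(C + 1)) s := by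
        simpa using (hasDerivAt_id s).const_mul (-(C + 1))
      exact (h1.exp.const_mul β).neg
    · intro s hs heq
      have hE := Real.exp_pos (-(C + 1) * s)
      have hk := hkey s (Ico_subset_Icc_self hs)
      have hd : ddir e m (γ s) = β * Real.exp (-(C + 1) * s) := by linarith [heq]
      have hdpos : 0 < ddir e m (γ s) := by rw [hd]; positivity
      rw [abs_of_pos hdpos] at hk
      have : -(β * (Real.exp (-(C + 1) * s) * (-(C + 1)))) = (C + 1) * ddir e m (γ s) := by
        rw [hd]; ring
      simp only [this]
      linarith
  have hmono : MonotoneOn (fun s => m (γ s)) (Icc (0:ℝ) 1) := by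
    refine monotoneOn_of_deriv_nonneg (convex_Icc 0 1) ?_ ?_ ?_
    · intro s hs; exact (hf1 s hs).continuousAt.continuousWithinAt
    · intro s hs
      exact (hf1 s (interior_subset hs)).differentiableAt.differentiableWithinAt
    · intro s hs
      rw [(hf1 s (interior_subset hs)).deriv]
      have := hfence (interior_subset hs)
      have hE : 0 < β * Real.exp (-(C + 1) * s) := mul_pos hpos (Real.exp_pos _)
      linarith
  have := hmono (left_mem_Icc.2 zero_le_one) (right_mem_Icc.2 zero_le_one) zero_le_one
  simpa [hγ0, hγ1] using this

end QC

section GEO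
variable {E : Type*} [NormedAddCommGroup E] [InnerProductSpace ℝ E] [CompleteSpace E]

lemma geo_line {m : E → ℝ} {v : E → E} {z : E} {R ε : ℝ}
    (hgrad : ∀ p ∈ ball z R, HasFDerivAt m (InnerProductSpace.toDual ℝ E (v p)) p)
    (hlip : ∀ p ∈ ball z R, ∀ p' ∈ ball z R, ‖v p - v p'‖ ≤ ε⁻¹ * ‖p - p'‖ * ‖v p'‖)
    {p u : E} {s : ℝ} (hs : 0 ≤ s) (hu : ‖u‖ = 1) (hp : p ∈ ball z R)
    (hps : p + s • u ∈ ball z R) :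
    m p + s * inner ℝ (v p) u - s ^ 2 * ‖v p‖ * ε⁻¹ / 2 ≤ m (p + s • u) := by
  have hmem : ∀ τ ∈ Icc (0:ℝ) s, p + τ • u ∈ ball z R := by
    intro τ hτ
    rcases hs.eq_or_lt with h0 | h0
    · have : τ = 0 := le_antisymm (by rw [h0]; exact hτ.2) hτ.1
      simpa [this] using hp
    · have h1 : τ / s ∈ Icc (0:ℝ) 1 := ⟨div_nonneg hτ.1 hs, (div_le_one h0).2 hτ.2⟩
      have := (convex_ball z R).add_smul_mem hp hps h1
      rwa [smul_smul, div_mul_cancel₀ _ h0.ne'] at this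
  have hd : ∀ τ ∈ Icc (0:ℝ) s, HasDerivAt
      (fun τ => m (p + τ • u) - τ * inner ℝ (v p) u + τ ^ 2 * (‖v p‖ * ε⁻¹ / 2))
      (inner ℝ (v (p + τ • u)) u - inner ℝ (v p) u + 2 * τ * (‖v p‖ * ε⁻¹ / 2)) τ := by
    intro τ hτ
    have h1 : HasDerivAt (fun τ : ℝ => p + τ • u) u τ := by
      simpa using ((hasDerivAt_id τ).smul_const u).const_add p
    have h2 := (hgrad _ (hmem τ hτ)).comp_hasDerivAt τ h1
    have h3 : HasDerivAt (fun τ : ℝ => τ * inner ℝ (v p) u) (inner ℝ (v p) u) τ := by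
      simpa using (hasDerivAt_id τ).mul_const (inner ℝ (v p) u)
    have h4 : HasDerivAt (fun τ : ℝ => τ ^ 2 * (‖v p‖ * ε⁻¹ / 2))
        (2 * τ * (‖v p‖ * ε⁻¹ / 2)) τ := by
      simpa using (hasDerivAt_pow 2 τ).mul_const (‖v p‖ * ε⁻¹ / 2)
    exact (h2.sub h3).add h4
  have hmono : MonotoneOn
      (fun τ => m (p + τ • u) - τ * inner ℝ (v p) u + τ ^ 2 * (‖v p‖ * ε⁻¹ / 2)) (Icc (0:ℝ) s) := by
    refine monotoneOn_of_deriv_nonneg (convex_Icc 0 s) ?_ ?_ ?_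
    · intro τ hτ; exact (hd τ hτ).continuousAt.continuousWithinAt
    · intro τ hτ
      exact (hd τ (interior_subset hτ)).differentiableAt.differentiableWithinAt
    · intro τ hτ
      rw [(hd τ (interior_subset hτ)).deriv]
      have hτ' := interior_subset hτ
      have h1 := hlip _ (hmem τ hτ') p hp
      have h2 : ‖p + τ • u - p‖ = τ := by
        rw [add_sub_cancel_left, norm_smul, hu, mul_one, Real.norm_eq_abs, abs_of_nonneg hτ'.1]
      rw [h2] at h1
      have h3 : |inner ℝ (v (p + τ • u) - v p) u| ≤ ‖v (p + τ • u) - v p‖ * ‖u‖ :=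
        abs_real_inner_le_norm _ _
      rw [hu, mul_one, inner_sub_left] at h3
      have h4 := neg_le_of_abs_le h3
      nlinarith
  have := hmono (left_mem_Icc.2 hs) (right_mem_Icc.2 hs) hs
  simp only [zero_smul, add_zero, zero_mul, sub_zero, ne_eq, OfNat.ofNat_ne_zero,
    not_false_eq_true, zero_pow] at this
  linarith

lemma geo_qc {m : E → ℝ} {v : E → E} {z : E} {R : ℝ}
    (hgrad : ∀ p ∈ ball z R, HasFDerivAt m (InnerProductSpace.toDual ℝ E (v p)) p)
    (hne : ∀ p ∈ ball z R, v p ≠ 0)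
    (hqc : ∀ p ∈ ball z R, ∀ w ∈ ball z R, 0 < inner ℝ (v p) (w - p) → m p ≤ m w)
    {p w : E} (hp : p ∈ ball z R) (hw : w ∈ ball z R) (h : 0 ≤ inner ℝ (v p) (w - p)) :
    m p ≤ m w := by
  have hc : Filter.Tendsto (fun t : ℝ => w + t • v p) (nhdsWithin 0 (Ioi 0)) (nhds w) := by
    have : Continuous (fun t : ℝ => w + t • v p) := by fun_prop
    have h2 := this.tendsto 0
    simp only [zero_smul, add_zero] at h2
    exact h2.mono_left nhdsWithin_le_nhds
  have hm := ((hgrad w hw).continuousAt.tendsto).comp hc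
  refine ge_of_tendsto hm ?_
  filter_upwards [hc.eventually (isOpen_ball.mem_nhds hw), self_mem_nhdsWithin] with t ht1 ht2
  apply hqc p hp _ ht1
  have : w + t • v p - p = (w - p) + t • v p := by abel
  rw [this, inner_add_right, inner_smul_right, real_inner_self_eq_norm_sq]
  have h3 : 0 < ‖v p‖ := norm_pos_iff.2 (hne p hp)
  have h4 : (0:ℝ) < t := ht2
  positivity

/-- forward estimate -/
lemma geo_fwd {m : E → ℝ} {v : E → E} {z : E} {r ε d : ℝ} (hr : 0 < r) (hε : 0 < ε)
    (hgrad : ∀ p ∈ ball z (4 * r), HasFDerivAt m (InnerProductSpace.toDual ℝ E (v p)) p)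
    (hlip : ∀ p ∈ ball z (4 * r), ∀ p' ∈ ball z (4 * r),
      ‖v p - v p'‖ ≤ ε⁻¹ * ‖p - p'‖ * ‖v p'‖)
    (hne : ∀ p ∈ ball z (4 * r), v p ≠ 0)
    (hqc : ∀ p ∈ ball z (4 * r), ∀ w ∈ ball z (4 * r), 0 < inner ℝ (v p) (w - p) → m p ≤ m w)
    (hd : d ≤ 2 * r) (hdε : d ≤ ε / 4)
    {q w : E} (hq : q ∈ ball z r) (hw : w ∈ ball z r) (hqw : ‖w - q‖ ≤ d)
    (hpos : 0 ≤ inner ℝ (v q) (w - q)) :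
    inner ℝ (v q) (w - q) ≤ 25 / 18 * (m w - m q) := by
  have hsub : ball z r ⊆ ball z (4 * r) := ball_subset_ball (by linarith)
  have hv : 0 < ‖v q‖ := norm_pos_iff.2 (hne q (hsub hq))
  set N := ‖v q‖ with hN
  set u : E := N⁻¹ • v q with hu
  have hun : ‖u‖ = 1 := by
    rw [hu, norm_smul, norm_inv, Real.norm_eq_abs, abs_of_pos hv, ← hN, inv_mul_cancel₀ hv.ne']
  have hvu : inner ℝ (v q) u = N := by
    rw [hu, inner_smul_right, real_inner_self_eq_norm_sq, ← hN]; field_simp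
  set T := inner ℝ u (w - q) with hT
  have hvT : inner ℝ (v q) (w - q) = N * T := by
    rw [hT, hu, inner_smul_left]; simp; field_simp
  have hT0 : 0 ≤ T := by
    rw [hvT] at hpos
    exact nonneg_of_mul_nonneg_right hpos hv
  have hTd : T ≤ d := by
    have := real_inner_le_norm u (w - q)
    rw [hun, one_mul] at this
    linarith
  set s := 4 / 5 * T with hs
  have hs0 : 0 ≤ s := by positivity
  set p := q + s • u with hp
  have hpq : ‖p - q‖ = s := by
    rw [hp, add_sub_cancel_left, norm_smul, hun, mul_one, Real.norm_eq_abs, abs_of_nonneg hs0]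
  have hpB : p ∈ ball z (4 * r) := by
    rw [mem_ball_iff_norm] at hq ⊢
    have : p - z = (p - q) + (q - z) := by abel
    rw [this]
    have := norm_add_le (p - q) (q - z)
    linarith
  have hline := geo_line hgrad hlip hs0 hun (hsub hq) hpB
  have hwp : ‖w - p‖ ≤ d := by
    have h1 : w - p = (w - q) - s • u := by rw [hp]; abel
    have h2 : ‖w - p‖ ^ 2 = ‖w - q‖ ^ 2 - 2 * (s * T) + s ^ 2 := by
      rw [h1, norm_sub_sq_real, inner_smul_right, real_inner_comm, ← hT, norm_smul, hun,
        Real.norm_eq_abs, abs_of_nonneg hs0, mul_one]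
    have h3 : ‖w - p‖ ^ 2 ≤ ‖w - q‖ ^ 2 := by rw [h2]; nlinarith
    exact (le_of_sq_le_sq h3 (norm_nonneg _)).trans hqw
  have hq2 : m p ≤ m w := by
    apply geo_qc hgrad hne hqc hpB (hsub hw)
    have h1 : inner ℝ (v p) (w - p) = inner ℝ (v q) (w - p) + inner ℝ (v p - v q) (w - p) := by
      rw [← inner_add_left]; congr 1; abel
    have h2 : inner ℝ (v q) (w - p) = N * (T - s) := by
      have : w - p = (w - q) - s • u := by rw [hp]; abel
      rw [this, inner_sub_right, hvT, inner_smul_right, hvu]; ring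
    have h3 := neg_le_of_abs_le (abs_real_inner_le_norm (v p - v q) (w - p))
    have h4 := hlip p hpB q (hsub hq)
    rw [hpq] at h4
    have h5 : ‖v p - v q‖ * ‖w - p‖ ≤ (ε⁻¹ * s * N) * (ε / 4) := by
      apply mul_le_mul h4 (hwp.trans hdε) (norm_nonneg _)
      positivity
    have h6 : (ε⁻¹ * s * N) * (ε / 4) = s * N / 4 := by field_simp
    rw [h1, h2]
    rw [h6] at h5
    have : N * (T - s) - s * N / 4 = 0 := by rw [hs]; ring
    linarith
  rw [hvu, ← hN] at hline
  have hsε : s * ε⁻¹ ≤ 1 / 5 := by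
    rw [← div_eq_mul_inv, div_le_iff₀ hε]; linarith
  have h7 : s ^ 2 * N * ε⁻¹ / 2 ≤ s * N / 10 := by
    have : s ^ 2 * N * ε⁻¹ / 2 = (s * N / 2) * (s * ε⁻¹) := by ring
    rw [this]
    have h8 : 0 ≤ s * N / 2 := by positivity
    nlinarith
  rw [hvT]
  have : s * N = 4 / 5 * (N * T) := by rw [hs]; ring
  linarith

/-- backward estimate -/
lemma geo_bwd {m : E → ℝ} {v : E → E} {z : E} {r ε d : ℝ} (hr : 0 < r) (hε : 0 < ε)
    (hgrad : ∀ p ∈ ball z (4 * r), HasFDerivAt m (InnerProductSpace.toDual ℝ E (v p)) p)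
    (hlip : ∀ p ∈ ball z (4 * r), ∀ p' ∈ ball z (4 * r),
      ‖v p - v p'‖ ≤ ε⁻¹ * ‖p - p'‖ * ‖v p'‖)
    (hne : ∀ p ∈ ball z (4 * r), v p ≠ 0)
    (hqc : ∀ p ∈ ball z (4 * r), ∀ w ∈ ball z (4 * r), 0 < inner ℝ (v p) (w - p) → m p ≤ m w)
    (hd : d ≤ 2 * r) (hdε : d ≤ ε / 4)
    {q w : E} (hq : q ∈ ball z r) (hw : w ∈ ball z r) (hqw : ‖w - q‖ ≤ d)
    (hpos : 0 ≤ inner ℝ (v q) (q - w)) :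
    m q - 14 / 9 * inner ℝ (v q) (q - w) ≤ m w := by
  have hsub : ball z r ⊆ ball z (4 * r) := ball_subset_ball (by linarith)
  have hv : 0 < ‖v q‖ := norm_pos_iff.2 (hne q (hsub hq))
  set N := ‖v q‖ with hN
  set u : E := -(N⁻¹ • v q) with hu
  have hun : ‖u‖ = 1 := by
    rw [hu, norm_neg, norm_smul, norm_inv, Real.norm_eq_abs, abs_of_pos hv, ← hN,
      inv_mul_cancel₀ hv.ne']
  have hvu : inner ℝ (v q) u = -N := by
    rw [hu, inner_neg_right, inner_smul_right, real_inner_self_eq_norm_sq, ← hN]; field_simp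
  set T := inner ℝ u (w - q) with hT
  have hvT : inner ℝ (v q) (w - q) = -(N * T) := by
    rw [hT, hu, inner_neg_left, inner_smul_left]; simp; field_simp
  have hvT' : inner ℝ (v q) (q - w) = N * T := by
    rw [← neg_sub, inner_neg_right, hvT]; ring
  have hT0 : 0 ≤ T := by
    rw [hvT'] at hpos
    exact nonneg_of_mul_nonneg_right hpos hv
  have hTd : T ≤ d := by
    have := real_inner_le_norm u (w - q)
    rw [hun, one_mul] at this
    linarith
  set s := 4 / 3 * T with hs
  have hs0 : 0 ≤ s := by positivity
  set p := q + s • u with hp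
  have hpq : ‖p - q‖ = s := by
    rw [hp, add_sub_cancel_left, norm_smul, hun, mul_one, Real.norm_eq_abs, abs_of_nonneg hs0]
  have hpB : p ∈ ball z (4 * r) := by
    rw [mem_ball_iff_norm] at hq ⊢
    have : p - z = (p - q) + (q - z) := by abel
    rw [this]
    have := norm_add_le (p - q) (q - z)
    linarith
  have hline := geo_line hgrad hlip hs0 hun (hsub hq) hpB
  have hwp : ‖w - p‖ ≤ d := by
    have h1 : w - p = (w - q) - s • u := by rw [hp]; abel
    have h2 : ‖w - p‖ ^ 2 = ‖w - q‖ ^ 2 - 2 * (s * T) + s ^ 2 := by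
      rw [h1, norm_sub_sq_real, inner_smul_right, real_inner_comm, ← hT, norm_smul, hun,
        Real.norm_eq_abs, abs_of_nonneg hs0, mul_one]
    have h3 : ‖w - p‖ ^ 2 ≤ ‖w - q‖ ^ 2 := by rw [h2]; nlinarith
    exact (le_of_sq_le_sq h3 (norm_nonneg _)).trans hqw
  have hq2 : m p ≤ m w := by
    apply geo_qc hgrad hne hqc hpB (hsub hw)
    have h1 : inner ℝ (v p) (w - p) = inner ℝ (v q) (w - p) + inner ℝ (v p - v q) (w - p) := by
      rw [← inner_add_left]; congr 1; abel
    have h2 : inner ℝ (v q) (w - p) = N * (s - T) := by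
      have : w - p = (w - q) - s • u := by rw [hp]; abel
      rw [this, inner_sub_right, hvT, inner_smul_right, hvu]; ring
    have h3 := neg_le_of_abs_le (abs_real_inner_le_norm (v p - v q) (w - p))
    have h4 := hlip p hpB q (hsub hq)
    rw [hpq] at h4
    have h5 : ‖v p - v q‖ * ‖w - p‖ ≤ (ε⁻¹ * s * N) * (ε / 4) := by
      apply mul_le_mul h4 (hwp.trans hdε) (norm_nonneg _)
      positivity
    have h6 : (ε⁻¹ * s * N) * (ε / 4) = s * N / 4 := by field_simp
    rw [h1, h2]
    rw [h6] at h5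
    have : N * (s - T) - s * N / 4 = 0 := by rw [hs]; ring
    linarith
  rw [hvu, ← hN] at hline
  have hsε : s * ε⁻¹ ≤ 1 / 3 := by
    rw [← div_eq_mul_inv, div_le_iff₀ hε]; linarith
  have h7 : s ^ 2 * N * ε⁻¹ / 2 ≤ s * N / 6 := by
    have : s ^ 2 * N * ε⁻¹ / 2 = (s * N / 2) * (s * ε⁻¹) := by ring
    rw [this]
    have h8 : 0 ≤ s * N / 2 := by positivity
    nlinarith
  rw [hvT']
  have : s * N = 4 / 3 * (N * T) := by rw [hs]; ring
  linarith

/-- The geometric core of the dual norm estimate. -/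
lemma geo_main {n : ℕ} (hn : 1 ≤ n) {m : E → ℝ} {v : E → E} {z : E} {r ε h ρ : ℝ} {K : Set E}
    (hr : 0 < r) (hε : 0 < ε)
    (hgrad : ∀ p ∈ ball z (4 * r), HasFDerivAt m (InnerProductSpace.toDual ℝ E (v p)) p)
    (hlip : ∀ p ∈ ball z (4 * r), ∀ p' ∈ ball z (4 * r),
      ‖v p - v p'‖ ≤ ε⁻¹ * ‖p - p'‖ * ‖v p'‖)
    (hne : ∀ p ∈ ball z (4 * r), v p ≠ 0)
    (hqc : ∀ p ∈ ball z (4 * r), ∀ w ∈ ball z (4 * r), 0 < inner ℝ (v p) (w - p) → m p ≤ m w)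
    (hKB : K ⊆ ball z r) (hKd : diam K ≤ ε / 4) (hKc : Convex ℝ K) (hK0 : (0 : E) ∈ K)
    (hKn : ∀ k ∈ K, -((n : ℝ)⁻¹ • k) ∈ K) (hρ0 : 0 < ρ) (hρ1 : ρ < 1)
    (hm0 : ∀ w ∈ K, m w ≤ 0)
    {k kt : E} (hk : k ∈ K) (hkt : kt ∈ K) (hmt : -h ≤ m (ρ • kt)) {w : E} (hw : w ∈ K) :
    inner ℝ w (v (ρ • k)) ≤ 8 * n / (1 - ρ) ^ 2 * h := by
  have hρK : ∀ a ∈ K, ρ • a ∈ K := by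
    intro a ha
    have := hKc.add_smul_mem hK0 (by simpa using ha) (t := ρ) ⟨hρ0.le, hρ1.le⟩
    simpa using this
  have hbdd : IsBounded K := isBounded_ball.subset hKB
  have hd2 : diam K ≤ 2 * r := (diam_mono hKB isBounded_ball).trans (diam_ball hr.le)
  have hdist : ∀ a ∈ K, ∀ b ∈ K, ‖a - b‖ ≤ diam K := by
    intro a ha b hb
    rw [← dist_eq_norm]; exact dist_le_diam_of_mem hbdd ha hb
  have h1ρ : 0 < 1 - ρ := by linarith
  -- general estimate
  have hgen : ∀ a ∈ K, ∀ b ∈ K, (1 - ρ) * inner ℝ (v (ρ • a)) b ≤ 25 / 18 * (-m (ρ • a)) := by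
    intro a ha
    have hqa := hρK a ha
    have hfw : ∀ b ∈ K, inner ℝ (v (ρ • a)) (b - ρ • a) ≤ 25 / 18 * (-m (ρ • a)) := by
      intro b hb
      rcases le_or_gt 0 (inner ℝ (v (ρ • a)) (b - ρ • a)) with hp | hp
      · have := geo_fwd hr hε hgrad hlip hne hqc hd2 hKd (hKB hqa) (hKB hb)
          (hdist _ hb _ hqa) hp
        linarith [hm0 b hb]
      · linarith [hm0 _ hqa]
    intro b hb
    have e1 := hfw a ha
    have e2 := hfw b hb
    rw [inner_sub_right, inner_smul_right] at e1 e2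
    nlinarith
  have hqt := hρK kt hkt
  have hq := hρK k hk
  have hh : 0 ≤ h := by linarith [hm0 _ hqt]
  have hnpos : (0:ℝ) < n := by exact_mod_cast hn
  have hn1 : (1:ℝ) ≤ n := by exact_mod_cast hn
  set q := ρ • k with hqdef
  set qt := ρ • kt with hqtdef
  -- lower bound on m q
  have hlow : (1 - ρ) * (-m q) ≤ ((1 - ρ) + 14 / 9 * (ρ * (1 + n) * (25 / 18))) * h := by
    have hA := hgen kt hkt kt hkt
    have hB := hgen kt hkt _ (hKn k hk)
    rw [inner_neg_right, inner_smul_right] at hB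
    have hC : (1 - ρ) * inner ℝ (v qt) (qt - q) ≤ ρ * (1 + n) * (25 / 18) * h := by
      rw [inner_sub_right, hqdef, hqtdef, inner_smul_right, inner_smul_right, ← hqtdef]
      have hmt' : 25 / 18 * (-m qt) ≤ 25 / 18 * h := by linarith
      have hA' : (1 - ρ) * inner ℝ (v qt) kt ≤ 25 / 18 * h := hA.trans hmt'
      have hB' : -((1 - ρ) * inner ℝ (v qt) k) ≤ n * (25 / 18 * h) := by
        have := hB.trans hmt'
        have h2 := mul_le_mul_of_nonneg_left this hnpos.le
        have h3 : (n:ℝ) * ((1 - ρ) * -((n:ℝ)⁻¹ * inner ℝ (v qt) k)) =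
          -((1 - ρ) * inner ℝ (v qt) k) := by field_simp
        rw [h3] at h2; exact h2
      have h4 := mul_le_mul_of_nonneg_left (add_le_add hA' hB') hρ0.le
      linarith
    rcases le_or_gt 0 (inner ℝ (v qt) (qt - q)) with hp | hp
    · have := geo_bwd hr hε hgrad hlip hne hqc hd2 hKd (hKB hqt) (hKB hq)
          (hdist _ hq _ hqt) hp
      have h5 : -m q ≤ h + 14 / 9 * inner ℝ (v qt) (qt - q) := by linarith
      have h6 := mul_le_mul_of_nonneg_left h5 h1ρ.le
      linarith
    · have hp' : 0 < inner ℝ (v qt) (q - qt) := by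
        rw [← neg_sub, inner_neg_right]; linarith
      have hsub : ball z r ⊆ ball z (4 * r) := ball_subset_ball (by linarith)
      have h5 := hqc qt (hsub (hKB hqt)) q (hsub (hKB hq)) hp'
      have h6 : -m q ≤ h := by linarith
      have h7 := mul_le_mul_of_nonneg_left h6 h1ρ.le
      have h8 : 0 ≤ 14 / 9 * (ρ * (1 + n) * (25 / 18)) * h := by positivity
      linarith
  have hD := hgen k hk w hw
  rw [← hqdef] at hD
  rw [real_inner_comm]
  rw [div_mul_eq_mul_div, le_div_iff₀ (by positivity)]
  have h9 : inner ℝ (v q) w * (1 - ρ) ^ 2 ≤ 25 / 18 * ((1 - ρ) * (-m q)) := by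
    have := mul_le_mul_of_nonneg_left hD h1ρ.le
    linarith
  refine (h9.trans (mul_le_mul_of_nonneg_left hlow (by norm_num))).trans ?_
  rw [← mul_assoc]
  apply mul_le_mul_of_nonneg_right _ hh
  have h10 : ρ * (1 + n) ≤ ρ * (2 * n) := by gcongr; linarith
  have h11 : (1 - ρ) ≤ (1 - ρ) * n := by nlinarith
  nlinarith
end GEO

section P4
open Filter Topology

lemma deriv2_sub {A B : ℝ → ℝ} {t : ℝ} (hA : ContDiffAt ℝ (2 : ℕ) A t)
    (hB : ContDiffAt ℝ (2 : ℕ) B t) :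
    deriv (deriv (fun s => A s - B s)) t = deriv (deriv A) t - deriv (deriv B) t := by
  have hd : ∀ {f : ℝ → ℝ}, ContDiffAt ℝ (2 : ℕ) f t → DifferentiableAt ℝ (deriv f) t := by
    intro f hf
    have h2 : ContDiffAt ℝ (1 : ℕ) (fderiv ℝ f) t := hf.fderiv_right (by norm_num)
    have : deriv f = fun s => fderiv ℝ f s 1 := by ext1 s; simp
    rw [this]
    exact (h2.clm_apply contDiffAt_const).differentiableAt (by norm_num)
  have hev : deriv (fun s => A s - B s) =ᶠ[𝓝 t] fun s => deriv A s - deriv B s := by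
    filter_upwards [hA.eventually (by simp), hB.eventually (by simp)] with s h1 h2
    exact deriv_fun_sub (h1.differentiableAt (by norm_num)) (h2.differentiableAt (by norm_num))
  rw [hev.deriv_eq]
  exact deriv_fun_sub (hd hA) (hd hB)

lemma deriv2_add {A B : ℝ → ℝ} {t : ℝ} (hA : ContDiffAt ℝ (2 : ℕ) A t)
    (hB : ContDiffAt ℝ (2 : ℕ) B t) :
    deriv (deriv (fun s => A s + B s)) t = deriv (deriv A) t + deriv (deriv B) t := by
  have h0 : deriv (deriv (fun s => A s - (- B s))) t =
      deriv (deriv A) t - deriv (deriv (fun s => - B s)) t := deriv2_sub hA hB.neg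
  have h1 : deriv (fun s => - B s) = fun s => - deriv B s := by ext1 s; exact deriv.fun_neg
  rw [h1, deriv.fun_neg] at h0
  simpa using h0

lemma deriv2_affine {B : ℝ → ℝ} {t a b : ℝ} (h : B =ᶠ[𝓝 t] fun s => a + s * b) :
    deriv (deriv B) t = 0 := by
  rw [h.deriv.deriv_eq]
  have : deriv (fun s : ℝ => a + s * b) = fun _ => b := by
    ext1 s
    have := ((hasDerivAt_id s).mul_const b).const_add a
    simpa using this.deriv
  rw [this]; simp

lemma deriv2_rescale (P : ℝ → ℝ) (t μ : ℝ) :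
    deriv (deriv (fun τ => P (t + μ * τ))) 0 = μ ^ 2 * deriv (deriv P) t := by
  have h1 : ∀ P : ℝ → ℝ, deriv (fun τ => P (t + μ * τ)) = fun τ => μ * deriv P (t + μ * τ) := by
    intro P
    ext1 τ
    have := deriv_comp_mul_left μ (fun u => P (t + u)) τ
    rw [this, deriv_comp_const_add]; rfl
  rw [h1, deriv_const_mul_field, congrFun (h1 (deriv P)) 0]
  simp; ring

variable {E : Type*} [NormedAddCommGroup E] [NormedSpace ℝ E]

lemma curve_y_contDiff {k : ℕ} (x : E) {yc : ℝ → E} {t : ℝ} (h : ContDiffAt ℝ k yc t) :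
    ContDiffAt ℝ k (fun s => (x, yc s)) t := contDiffAt_const.prodMk h

lemma d1y {f : E × E → ℝ} {x : E} {yc : ℝ → E} {t : ℝ} (hf : DifferentiableAt ℝ f (x, yc t))
    (hy : DifferentiableAt ℝ yc t) :
    HasDerivAt (fun s => f (x, yc s)) (ddir (0, deriv yc t) f (x, yc t)) t := by
  have h1 : HasDerivAt (fun s => (x, yc s)) ((0 : E), deriv yc t) t :=
    (hasDerivAt_const t x).prodMk hy.hasDerivAt
  have h := deriv_along (f := f) (α := fun s => (x, yc s)) hf h1.differentiableAt
  rwa [h1.deriv] at h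

lemma d1x {f : E × E → ℝ} {y : E} {xc : ℝ → E} {t : ℝ} (hf : DifferentiableAt ℝ f (xc t, y))
    (hx : DifferentiableAt ℝ xc t) :
    HasDerivAt (fun s => f (xc s, y)) (ddir (deriv xc t, 0) f (xc t, y)) t := by
  have h1 : HasDerivAt (fun s => (xc s, y)) (deriv xc t, (0 : E)) t :=
    hx.hasDerivAt.prodMk (hasDerivAt_const t y)
  have h := deriv_along (f := f) (α := fun s => (xc s, y)) hf h1.differentiableAt
  rwa [h1.deriv] at h

lemma deriv_diff {k : ℝ → E} {t : ℝ} (hk : ContDiffAt ℝ (2 : ℕ) k t) :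
    DifferentiableAt ℝ (deriv k) t := by
  have h2 : ContDiffAt ℝ (1 : ℕ) (fderiv ℝ k) t := hk.fderiv_right (by norm_num)
  have : deriv k = fun s => fderiv ℝ k s 1 := by ext1 s; simp
  rw [this]
  exact (h2.clm_apply contDiffAt_const).differentiableAt (by norm_num)

lemma d2y {f : E × E → ℝ} {x : E} {yc : ℝ → E} {t : ℝ} (hf : ContDiffAt ℝ (2 : ℕ) f (x, yc t))
    (hy : ContDiffAt ℝ (2 : ℕ) yc t) :
    HasDerivAt (deriv (fun s => f (x, yc s)))
      (ddir (0, deriv yc t) (ddir (0, deriv yc t) f) (x, yc t) +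
        ddir (0, deriv (deriv yc) t) f (x, yc t)) t := by
  have h1 : ∀ s, DifferentiableAt ℝ yc s →
      deriv (fun s => (x, yc s)) s = ((0 : E), deriv yc s) := fun s hs =>
    ((hasDerivAt_const s x).prodMk hs.hasDerivAt).deriv
  have h2 : deriv (fun s => (x, yc s)) =ᶠ[𝓝 t] fun s => ((0 : E), deriv yc s) := by
    filter_upwards [hy.eventually (by simp)] with s hs
    exact h1 s (hs.differentiableAt (by norm_num))
  have h3 : deriv (deriv (fun s => (x, yc s))) t = ((0 : E), deriv (deriv yc) t) := by
    rw [h2.deriv_eq]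
    exact ((hasDerivAt_const t (0:E)).prodMk (deriv_diff hy).hasDerivAt).deriv
  have h := deriv2_along (f := f) (α := fun s => (x, yc s)) hf (curve_y_contDiff x hy)
  rwa [h3, h1 t (hy.differentiableAt (by norm_num))] at h

lemma d2x {f : E × E → ℝ} {y : E} {xc : ℝ → E} {t : ℝ} (hf : ContDiffAt ℝ (2 : ℕ) f (xc t, y))
    (hx : ContDiffAt ℝ (2 : ℕ) xc t) :
    HasDerivAt (deriv (fun s => f (xc s, y)))
      (ddir (deriv xc t, 0) (ddir (deriv xc t, 0) f) (xc t, y) +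
        ddir (deriv (deriv xc) t, 0) f (xc t, y)) t := by
  have h1 : ∀ s, DifferentiableAt ℝ xc s →
      deriv (fun s => (xc s, y)) s = (deriv xc s, (0 : E)) := fun s hs =>
    (hs.hasDerivAt.prodMk (hasDerivAt_const s y)).deriv
  have h2 : deriv (fun s => (xc s, y)) =ᶠ[𝓝 t] fun s => (deriv xc s, (0 : E)) := by
    filter_upwards [hx.eventually (by simp)] with s hs
    exact h1 s (hs.differentiableAt (by norm_num))
  have h3 : deriv (deriv (fun s => (xc s, y))) t = (deriv (deriv xc) t, (0 : E)) := by
    rw [h2.deriv_eq]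
    exact ((deriv_diff hx).hasDerivAt.prodMk (hasDerivAt_const t (0:E))).deriv
  have h := deriv2_along (f := f) (α := fun s => (xc s, y)) hf (hx.prodMk contDiffAt_const)
  rwa [h3, h1 t (hx.differentiableAt (by norm_num))] at h

end P4

section COST
open Filter Topology
variable {n : ℕ} {c : Euc n → Euc n → ℝ} {U V : Set (Euc n)}

lemma cost_reg (hB0 : B0cond n c U V) {x y : Euc n} (hx : x ∈ U) (hy : y ∈ V) :
    ContDiffAt ℝ (4 : ℕ) (Function.uncurry c) (x, y) := by
  obtain ⟨hU, -, hV, -, hc⟩ := hB0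
  exact hc.contDiffAt (prod_mem_nhds (mem_of_superset (hU.mem_nhds hx) subset_closure)
    (mem_of_superset (hV.mem_nhds hy) subset_closure))

lemma gradX_inner {x y : Euc n} (h : DifferentiableAt ℝ (Function.uncurry c) (x, y))
    (v : Euc n) : inner ℝ (gradX n c x y) v = ddir (v, 0) (Function.uncurry c) (x, y) := by
  unfold gradX gradient
  rw [InnerProductSpace.toDual_symm_apply]
  have h1 : HasFDerivAt (fun x' => Function.uncurry c (x', y))
      ((fderiv ℝ (Function.uncurry c) (x, y)).comp (ContinuousLinearMap.inl ℝ _ _)) x :=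
    HasFDerivAt.comp (g := Function.uncurry c) (f := fun e : Euc n => (e, y)) x h.hasFDerivAt
      (hasFDerivAt_prodMk_left (𝕜 := ℝ) x y)
  have h2 := h1.fderiv
  change fderiv ℝ (fun x' => Function.uncurry c (x', y)) x v = _
  rw [h2]; rfl

lemma gradY_inner {x y : Euc n} (h : DifferentiableAt ℝ (Function.uncurry c) (x, y))
    (v : Euc n) : inner ℝ (gradY n c x y) v = ddir (0, v) (Function.uncurry c) (x, y) := by
  unfold gradY gradient
  rw [InnerProductSpace.toDual_symm_apply]
  have h1 : HasFDerivAt (fun x' => Function.uncurry c (x, x'))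
      ((fderiv ℝ (Function.uncurry c) (x, y)).comp (ContinuousLinearMap.inr ℝ _ _)) y :=
    h.hasFDerivAt.comp y (hasFDerivAt_prodMk_right x y)
  have h2 := h1.fderiv
  change fderiv ℝ (fun x' => Function.uncurry c (x, x')) y v = _
  rw [h2]; rfl

lemma gradX_contDiffAt (hB0 : B0cond n c U V) {x y : Euc n} (hx : x ∈ U) (hy : y ∈ V) :
    ContDiffAt ℝ (3 : ℕ) (fun z : Euc n × Euc n => gradX n c z.1 z.2) (x, y) := by
  have hF := cost_reg hB0 hx hy
  have hev : (fun z : Euc n × Euc n => gradX n c z.1 z.2) =ᶠ[𝓝 (x, y)] fun z =>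
      (InnerProductSpace.toDual ℝ (Euc n)).symm
        ((fderiv ℝ (Function.uncurry c) z).comp (ContinuousLinearMap.inl ℝ _ _)) := by
    filter_upwards [hF.eventually (by simp)] with z hz
    apply ext_inner_right ℝ
    intro v
    rw [gradX_inner (hz.differentiableAt (by norm_num)), InnerProductSpace.toDual_symm_apply]
    rfl
  refine ContDiffAt.congr_of_eventuallyEq ?_ hev
  have h1 : ContDiffAt ℝ (3 : ℕ) (fderiv ℝ (Function.uncurry c)) (x, y) :=
    hF.fderiv_right (by norm_num)
  have h2 : ContDiffAt ℝ (3 : ℕ) (fun z => (fderiv ℝ (Function.uncurry c) z).comp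
    (ContinuousLinearMap.inl ℝ (Euc n) (Euc n))) (x, y) := h1.clm_comp contDiffAt_const
  exact (InnerProductSpace.toDual ℝ (Euc n)).symm.contDiff.contDiffAt.comp (x, y) h2

lemma gradY_contDiffAt (hB0 : B0cond n c U V) {x y : Euc n} (hx : x ∈ U) (hy : y ∈ V) :
    ContDiffAt ℝ (3 : ℕ) (fun z : Euc n × Euc n => gradY n c z.1 z.2) (x, y) := by
  have hF := cost_reg hB0 hx hy
  have hev : (fun z : Euc n × Euc n => gradY n c z.1 z.2) =ᶠ[𝓝 (x, y)] fun z =>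
      (InnerProductSpace.toDual ℝ (Euc n)).symm
        ((fderiv ℝ (Function.uncurry c) z).comp (ContinuousLinearMap.inr ℝ _ _)) := by
    filter_upwards [hF.eventually (by simp)] with z hz
    apply ext_inner_right ℝ
    intro v
    rw [gradY_inner (hz.differentiableAt (by norm_num)), InnerProductSpace.toDual_symm_apply]
    rfl
  refine ContDiffAt.congr_of_eventuallyEq ?_ hev
  have h1 : ContDiffAt ℝ (3 : ℕ) (fderiv ℝ (Function.uncurry c)) (x, y) :=
    hF.fderiv_right (by norm_num)
  have h2 : ContDiffAt ℝ (3 : ℕ) (fun z => (fderiv ℝ (Function.uncurry c) z).comp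
    (ContinuousLinearMap.inr ℝ (Euc n) (Euc n))) (x, y) := h1.clm_comp contDiffAt_const
  exact (InnerProductSpace.toDual ℝ (Euc n)).symm.contDiff.contDiffAt.comp (x, y) h2

lemma gradY_x_contDiffAt (hB0 : B0cond n c U V) {x y : Euc n} (hx : x ∈ U) (hy : y ∈ V) :
    ContDiffAt ℝ (3 : ℕ) (fun x' => gradY n c x' y) x :=
  ContDiffAt.comp (g := fun z : Euc n × Euc n => gradY n c z.1 z.2)
    (f := fun x' : Euc n => (x', y)) x (gradY_contDiffAt hB0 hx hy)
    (contDiffAt_id.prodMk contDiffAt_const)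

lemma gradX_y_contDiffAt (hB0 : B0cond n c U V) {x y : Euc n} (hx : x ∈ U) (hy : y ∈ V) :
    ContDiffAt ℝ (3 : ℕ) (fun y' => gradX n c x y') y :=
  ContDiffAt.comp (g := fun z : Euc n × Euc n => gradX n c z.1 z.2)
    (f := fun y' : Euc n => (x, y')) y (gradX_contDiffAt hB0 hx hy)
    (contDiffAt_const.prodMk contDiffAt_id)

/-- The mixed derivative in terms of directional derivatives. -/
lemma Dxy_inner (hB0 : B0cond n c U V) {x y : Euc n} (hx : x ∈ U) (hy : y ∈ V) (v w : Euc n) :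
    inner ℝ (DxyC n c x y v) w = ddir (v, 0) (ddir (0, w) (Function.uncurry c)) (x, y) := by
  have hF := cost_reg hB0 hx hy
  have hd : DifferentiableAt ℝ (fun x' => gradY n c x' y) x :=
    (gradY_x_contDiffAt hB0 hx hy).differentiableAt (by norm_num)
  have h1 : HasFDerivAt (fun x' => inner ℝ (gradY n c x' y) w)
      ((innerSL ℝ w).comp (fderiv ℝ (fun x' => gradY n c x' y) x)) x := by
    have := (innerSL ℝ w).hasFDerivAt.comp x hd.hasFDerivAt
    refine this.congr_of_eventuallyEq (Eventually.of_forall fun x' => ?_)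
    simp [real_inner_comm]
  have hev : (fun x' => inner ℝ (gradY n c x' y) w) =ᶠ[𝓝 x]
      fun x' => ddir (0, w) (Function.uncurry c) (x', y) := by
    have hc : ContinuousAt (fun x' : Euc n => (x', y)) x := by fun_prop
    filter_upwards [hc.eventually (hF.eventually (by simp))] with x' hx'
    exact gradY_inner (hx'.differentiableAt (by norm_num)) w
  have h2 : HasFDerivAt (fun x' => ddir (0, w) (Function.uncurry c) (x', y))
      ((fderiv ℝ (ddir (0, w) (Function.uncurry c)) (x, y)).comp
        (ContinuousLinearMap.inl ℝ _ _)) x :=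
    HasFDerivAt.comp (g := ddir (0, w) (Function.uncurry c)) (f := fun e : Euc n => (e, y)) x
      ((ddir_contDiffAt (m := 3) hF (by norm_num) (0, w)).differentiableAt
      (by norm_num)).hasFDerivAt (hasFDerivAt_prodMk_left (𝕜 := ℝ) x y)
  have h3 := (h2.congr_of_eventuallyEq hev).unique h1
  have h4 := DFunLike.congr_fun h3 v
  simp only [ContinuousLinearMap.comp_apply, innerSL_apply_apply] at h4
  unfold DxyC
  rw [real_inner_comm, ← h4]; rfl

end COST

section P5
open Filter Topology

lemma cross_swap {E : Type*} [NormedAddCommGroup E] [NormedSpace ℝ E] {F : E × E → ℝ}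
    {xc yc : ℝ → E} {x0 y0 ξ χ η ζ : E} (hx0 : xc 0 = x0) (hy0 : yc 0 = y0)
    (hF : ContDiffAt ℝ (4 : ℕ) F (x0, y0))
    (hx : ContDiffAt ℝ (2 : ℕ) xc 0) (hy : ContDiffAt ℝ (2 : ℕ) yc 0)
    (hξ : deriv xc 0 = ξ) (hχ : deriv (deriv xc) 0 = χ)
    (hη : deriv yc 0 = η) (hζ : deriv (deriv yc) 0 = ζ)
    {a b a' b' : ℝ}
    (hax : (fun s => ddir (0, ζ) F (xc s, y0)) =ᶠ[𝓝 0] fun s => a + s * b)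
    (hay : (fun t => ddir (χ, 0) F (x0, yc t)) =ᶠ[𝓝 0] fun t => a' + t * b') :
    deriv (deriv (fun s => deriv (deriv (fun t => F (xc s, yc t))) 0)) 0 =
      deriv (deriv (fun t => ddir (ξ, 0) (ddir (ξ, 0) F) (x0, yc t))) 0 := by
  have hxc : ContinuousAt (fun s => (xc s, y0)) 0 := hx.continuousAt.prodMk continuousAt_const
  have hFev : ∀ᶠ s in 𝓝 (0 : ℝ), ContDiffAt ℝ (4 : ℕ) F (xc s, y0) := by
    apply hxc.eventually
    simp only [hx0]
    exact hF.eventually (by simp)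
  have hF3 : ∀ v, ContDiffAt ℝ (3 : ℕ) (ddir v F) (x0, y0) := fun v =>
    ddir_contDiffAt hF (by norm_num) v
  have hF2 : ∀ v w, ContDiffAt ℝ (2 : ℕ) (ddir w (ddir v F)) (x0, y0) := fun v w =>
    ddir_contDiffAt (hF3 v) (by norm_num) w
  have h1 : (fun s => deriv (deriv (fun t => F (xc s, yc t))) 0) =ᶠ[𝓝 0]
      fun s => ddir (0, η) (ddir (0, η) F) (xc s, y0) + ddir (0, ζ) F (xc s, y0) := by
    filter_upwards [hFev] with s hs
    have := (d2y (f := F) (x := xc s) (yc := yc) (t := 0)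
      (by rw [hy0]; exact hs.of_le (by norm_num)) hy).deriv
    rw [hη, hζ, hy0] at this
    exact this
  have hcx : ∀ {f : E × E → ℝ}, ContDiffAt ℝ (2 : ℕ) f (x0, y0) →
      ContDiffAt ℝ (2 : ℕ) (fun s => f (xc s, y0)) 0 := by
    intro f hf
    refine ContDiffAt.comp (g := f) (f := fun s => (xc s, y0)) 0 ?_ (hx.prodMk contDiffAt_const)
    rw [hx0]; exact hf
  rw [h1.deriv.deriv_eq, deriv2_add (hcx (hF2 _ _)) (hcx ((hF3 _).of_le (by norm_num))),
    deriv2_affine hax]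
  have e1 : ∀ {f : E × E → ℝ}, ContDiffAt ℝ (2 : ℕ) f (x0, y0) →
      deriv (deriv (fun s => f (xc s, y0))) 0 =
        ddir (ξ, 0) (ddir (ξ, 0) f) (x0, y0) + ddir (χ, 0) f (x0, y0) := by
    intro f hf
    have := (d2x (f := f) (y := y0) (xc := xc) (t := 0) (by rw [hx0]; exact hf) hx).deriv
    rw [hξ, hχ, hx0] at this
    exact this
  have e2 : ∀ {f : E × E → ℝ}, ContDiffAt ℝ (2 : ℕ) f (x0, y0) →
      deriv (deriv (fun s => f (x0, yc s))) 0 =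
        ddir (0, η) (ddir (0, η) f) (x0, y0) + ddir (0, ζ) f (x0, y0) := by
    intro f hf
    have := (d2y (f := f) (x := x0) (yc := yc) (t := 0) (by rw [hy0]; exact hf) hy).deriv
    rw [hη, hζ, hy0] at this
    exact this
  rw [e1 (hF2 _ _), e2 (hF2 _ _), ddir_comm4 hF]
  have z1 := deriv2_affine hax
  rw [e1 ((hF3 _).of_le (by norm_num))] at z1
  have z2 := deriv2_affine hay
  rw [e2 ((hF3 _).of_le (by norm_num))] at z2
  have c1 := ddir_comm3 (hF.of_le (by norm_num)) ((χ, 0) : E × E) (0, η)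
  have c2 := ddir_comm3 (hF.of_le (by norm_num)) ((0, ζ) : E × E) (ξ, 0)
  have c3 := ddir_comm (hF.of_le (by norm_num)) ((0, ζ) : E × E) (χ, 0)
  linarith

variable {n : ℕ} {c : Euc n → Euc n → ℝ} {U V : Set (Euc n)}

lemma negGradY_contDiffAt (hB0 : B0cond n c U V) {x y : Euc n} (hx : x ∈ U) (hy : y ∈ V) :
    ContDiffAt ℝ (3 : ℕ) (fun x' => -gradY n c x' y) x := (gradY_x_contDiffAt hB0 hx hy).neg

lemma a3_local (hB0 : B0cond n c U V) (hB1 : B1cond n c U V) (hB3 : B3cond n c U V)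
    {x0 : Euc n} (hx0 : x0 ∈ U) {yc : ℝ → Euc n} (hyV : ∀ t ∈ Icc (-1 : ℝ) 1, yc t ∈ V)
    (hyc : ContDiffAt ℝ (2 : ℕ) yc 0) {a b ξ : Euc n}
    (haff : ∀ t ∈ Icc (-1 : ℝ) 1, gradX n c x0 (yc t) = a + t • b)
    (hort : inner ℝ b ξ = 0) :
    deriv (deriv (fun t => ddir (ξ, 0) (ddir (ξ, 0) (Function.uncurry c)) (x0, yc t))) 0 ≤ 0 := by
  have hUo := hB0.1
  set y0 := yc 0 with hy0
  have hy0V : y0 ∈ V := hyV 0 (by norm_num)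
  set f : Euc n → Euc n := fun x => -gradY n c x y0 with hf
  obtain ⟨hinj, -, hg⟩ := hB1.1 y0 (subset_closure hy0V)
  have hclU : closure U ∈ 𝓝 x0 := mem_of_superset (hUo.mem_nhds hx0) subset_closure
  have hfC : ContDiffAt ℝ (3 : ℕ) f x0 := negGradY_contDiffAt hB0 hx0 hy0V
  obtain ⟨hgC, hmap⟩ := inv_nhds hinj hg hclU (by norm_num) hfC
  set g := Function.invFunOn f (closure U) with hgdef
  have hgf : ∀ z ∈ closure U, g (f z) = z := fun z hz => hinj.leftInvOn_invFunOn hz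
  have himg : f '' U ∈ 𝓝 (f x0) := by
    rw [hmap]; exact image_mem_map (hUo.mem_nhds hx0)
  set e' := fderiv ℝ f x0 ξ with he'
  -- scale
  obtain ⟨lam, hlam, hseg⟩ : ∃ lam : ℝ, 0 < lam ∧ ∀ s ∈ Icc (-1 : ℝ) 1,
      f x0 + s • (lam • e') ∈ f '' U := by
    have hc : ContinuousAt (fun r : ℝ => f x0 + r • e') 0 := by fun_prop
    have h1 : ∀ᶠ r in 𝓝 (0 : ℝ), f x0 + r • e' ∈ f '' U := by
      have h0 : ∀ᶠ p in 𝓝 (f x0 + (0 : ℝ) • e'), p ∈ f '' U := by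
        rw [zero_smul, add_zero]; exact himg
      exact hc.eventually h0
    obtain ⟨δ, hδ, h2⟩ := Metric.eventually_nhds_iff.1 h1
    refine ⟨δ / 2, by positivity, fun s hs => ?_⟩
    rw [smul_smul]
    apply h2
    rw [Real.dist_eq, sub_zero, abs_mul, abs_of_pos (half_pos hδ)]
    have : |s| ≤ 1 := abs_le.2 hs
    nlinarith
  set xc : ℝ → Euc n := fun s => g (f x0 + s • (lam • e')) with hxc
  have hxc0 : xc 0 = x0 := by
    simp only [hxc, zero_smul, add_zero]
    exact hgf x0 (subset_closure hx0)
  have hxU : ∀ s ∈ Icc (-1 : ℝ) 1, xc s ∈ U := by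
    intro s hs
    obtain ⟨z, hz, hzs⟩ := hseg s hs
    simp only [hxc]
    rw [← hzs, hgf z (subset_closure hz)]; exact hz
  have hfx : ∀ s ∈ Icc (-1 : ℝ) 1, f (xc s) = f x0 + s • (lam • e') := by
    intro s hs
    obtain ⟨z, hz, hzs⟩ := hseg s hs
    simp only [hxc]
    rw [← hzs, hgf z (subset_closure hz)]
  have hline : ContDiffAt ℝ (3 : ℕ) (fun s : ℝ => f x0 + s • (lam • e')) 0 := by fun_prop
  have hxcC : ContDiffAt ℝ (3 : ℕ) xc 0 := by
    refine ContDiffAt.comp (g := g) (f := fun s : ℝ => f x0 + s • (lam • e')) 0 ?_ hline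
    simpa using hgC
  have hderiv : deriv xc 0 = lam • ξ := by
    have hgd : HasFDerivAt g (fderiv ℝ g (f x0)) (f x0) :=
      (hgC.differentiableAt (by norm_num)).hasFDerivAt
    have hfd : HasFDerivAt f (fderiv ℝ f x0) x0 :=
      (hfC.differentiableAt (by norm_num)).hasFDerivAt
    have hcomp := hgd.comp x0 hfd
    have hid : HasFDerivAt (fun z : Euc n => z) ((fderiv ℝ g (f x0)).comp (fderiv ℝ f x0)) x0 := by
      refine hcomp.congr_of_eventuallyEq ?_
      filter_upwards [hclU] with z hz
      exact (hgf z hz).symm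
    have hu := hid.unique (hasFDerivAt_id x0)
    have hl : HasDerivAt (fun s : ℝ => f x0 + s • (lam • e')) (lam • e') 0 := by
      simpa using ((hasDerivAt_id (0 : ℝ)).smul_const (lam • e')).const_add (f x0)
    have hgd' : HasFDerivAt g (fderiv ℝ g (f x0)) ((fun s : ℝ => f x0 + s • (lam • e')) 0) := by
      simpa using hgd
    have := (hgd'.comp_hasDerivAt (0 : ℝ) hl).deriv
    change deriv xc 0 = _ at this
    rw [this, map_smul]
    congr 1
    exact DFunLike.congr_fun hu ξ
  set χ := deriv (deriv xc) 0 with hχ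
  set η := deriv yc 0 with hη
  set ζ := deriv (deriv yc) 0 with hζ
  set F := Function.uncurry c with hFdef
  have hF : ContDiffAt ℝ (4 : ℕ) F (x0, y0) := cost_reg hB0 hx0 hy0V
  have hIcc : ∀ᶠ s in 𝓝 (0 : ℝ), s ∈ Icc (-1 : ℝ) 1 := Icc_mem_nhds (by norm_num) (by norm_num)
  have hax : (fun s => ddir (0, ζ) F (xc s, y0)) =ᶠ[𝓝 0]
      fun s => inner ℝ (-(f x0)) ζ + s * inner ℝ (-(lam • e')) ζ := by
    filter_upwards [hIcc] with s hs
    rw [← gradY_inner ((cost_reg hB0 (hxU s hs) hy0V).differentiableAt (by norm_num))]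
    have h1 : gradY n c (xc s) y0 = -(f x0) + s • (-(lam • e')) := by
      have := hfx s hs
      rw [hf] at this
      simp only at this
      rw [← neg_neg (gradY n c (xc s) y0), this]
      simp [hf]; abel
    rw [h1, inner_add_left, real_inner_smul_left]
  have hay : ∀ v, (fun t => ddir (v, 0) F (x0, yc t)) =ᶠ[𝓝 0]
      fun t => inner ℝ a v + t * inner ℝ b v := by
    intro v
    filter_upwards [hIcc] with t ht
    rw [← gradX_inner ((cost_reg hB0 hx0 (hyV t ht)).differentiableAt (by norm_num)), haff t ht,
      inner_add_left, real_inner_smul_left]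
  have hxc2 : ContDiffAt ℝ (2 : ℕ) xc 0 := hxcC.of_le (by norm_num)
  have hswap := cross_swap (F := F) hxc0 hy0.symm hF hxc2 hyc hderiv rfl rfl rfl hax (hay χ)
  have hb3 := hB3 xc yc (fun t ht => subset_closure (hxU t ht))
    (fun t ht => subset_closure (hyV t ht)) ?_ ?_
  · have h4 : crossDiff4 n c xc yc =
        deriv (deriv (fun s => deriv (deriv (fun t => F (xc s, yc t))) 0)) 0 := rfl
    rw [h4, hswap] at hb3
    have hsc : (fun t => ddir (lam • ξ, 0) (ddir (lam • ξ, 0) F) (x0, yc t)) =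
        fun t => lam ^ 2 * ddir (ξ, 0) (ddir (ξ, 0) F) (x0, yc t) := by
      have k1 : ((lam • ξ, 0) : Euc n × Euc n) = lam • (ξ, 0) := by simp
      have k2 : ∀ (v : Euc n × Euc n) (f : Euc n × Euc n → ℝ),
          ddir (lam • v) f = fun z => lam • ddir v f z := by
        intro v f; ext1 z; simp [ddir]
      ext1 t
      rw [k1, k2, k2]
      simp only
      have k3 : ddir (ξ, 0) (fun z => lam • ddir ((ξ, 0) : Euc n × Euc n) F z) (x0, yc t) =
          lam • ddir (ξ, 0) (ddir (ξ, 0) F) (x0, yc t) := by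
        have k4 : (fun z => lam • ddir ((ξ, 0) : Euc n × Euc n) F z) =
          lam • (ddir ((ξ, 0) : Euc n × Euc n) F) := rfl
        rw [k4]
        unfold ddir
        rw [fderiv_const_smul_field]; rfl
      rw [k3]; simp; ring
    rw [hsc] at hb3
    have hsc2 : deriv (fun t => lam ^ 2 * ddir (ξ, 0) (ddir (ξ, 0) F) (x0, yc t)) =
        fun t => lam ^ 2 * deriv (fun t => ddir (ξ, 0) (ddir (ξ, 0) F) (x0, yc t)) t := by
      ext1 t; exact deriv_const_mul_field _
    rw [hsc2, deriv_const_mul_field] at hb3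
    by_contra hcon
    push Not at hcon
    have := mul_pos (pow_pos hlam 2) hcon
    linarith
  · refine ⟨(-(f x0), a), (-(lam • e'), b), fun t ht => ?_⟩
    have h1 : gradY n c (xc t) y0 = -(f x0) + t • (-(lam • e')) := by
      have := hfx t ht
      rw [hf] at this
      simp only at this
      rw [← neg_neg (gradY n c (xc t) y0), this]
      simp [hf]; abel
    ext1
    · simpa using h1
    · simp only [hxc0]; simpa using haff t ht
  · unfold crossDiff2
    have hd : (fun s => deriv (fun t => c (xc s) (yc t)) 0) =ᶠ[𝓝 0]
        fun s => ddir (0, η) F (xc s, y0) := by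
      filter_upwards [hIcc] with s hs
      exact (d1y (f := F) (x := xc s) (yc := yc) (t := 0)
        ((cost_reg hB0 (hxU s hs) hy0V).differentiableAt (by norm_num))
        (hyc.differentiableAt (by norm_num))).deriv
    rw [hd.deriv_eq]
    have hd1 : DifferentiableAt ℝ (ddir (0, η) F) (xc 0, y0) := by
      rw [hxc0]
      exact (ddir_contDiffAt (m := 3) hF (by norm_num) _).differentiableAt (by norm_num)
    rw [(d1x (f := ddir (0, η) F) (y := y0) (xc := xc) (t := 0) hd1
      (hxc2.differentiableAt (by norm_num))).deriv, hxc0, hderiv,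
      ddir_comm (hF.of_le (by norm_num))]
    have hd2 : DifferentiableAt ℝ (ddir (lam • ξ, 0) F) (x0, yc 0) :=
      (ddir_contDiffAt (m := 3) hF (by norm_num) _).differentiableAt (by norm_num)
    rw [← (d1y (f := ddir (lam • ξ, 0) F) (x := x0) (yc := yc) (t := 0) hd2
      (hyc.differentiableAt (by norm_num))).deriv, (hay (lam • ξ)).deriv_eq]
    have : HasDerivAt (fun t : ℝ => inner ℝ a (lam • ξ) + t * inner ℝ b (lam • ξ))
      (inner ℝ b (lam • ξ)) 0 := by
      simpa using ((hasDerivAt_id (0 : ℝ)).mul_const (inner ℝ b (lam • ξ))).const_add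
        (inner ℝ a (lam • ξ))
    rw [this.deriv, real_inner_smul_right, hort, mul_zero]

end P5

section P6
open Filter Topology

lemma one_dim_concave {P : ℝ → ℝ} (hP : ∀ t ∈ Icc (0 : ℝ) 1, ContDiffAt ℝ (2 : ℕ) P t)
    (h0 : deriv P 0 = 0) (h2 : ∀ t ∈ Ioo (0 : ℝ) 1, deriv (deriv P) t ≤ 0) : P 1 ≤ P 0 := by
  have hd : ∀ t ∈ Icc (0 : ℝ) 1, DifferentiableAt ℝ (deriv P) t := fun t ht => deriv_diff (hP t ht)
  have hanti : AntitoneOn (deriv P) (Icc 0 1) := by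
    apply antitoneOn_of_deriv_nonpos (convex_Icc 0 1)
    · exact fun t ht => (hd t ht).continuousAt.continuousWithinAt
    · rw [interior_Icc]
      exact fun t ht => (hd t (Ioo_subset_Icc_self ht)).differentiableWithinAt
    · rw [interior_Icc]; exact h2
  have hanti2 : AntitoneOn P (Icc 0 1) := by
    apply antitoneOn_of_deriv_nonpos (convex_Icc 0 1)
    · exact fun t ht => (hP t ht).continuousAt.continuousWithinAt
    · rw [interior_Icc]
      exact fun t ht => ((hP t (Ioo_subset_Icc_self ht)).differentiableAt
        (by norm_num)).differentiableWithinAt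
    · rw [interior_Icc]
      intro t ht
      have := hanti (left_mem_Icc.2 zero_le_one) (Ioo_subset_Icc_self ht) ht.1.le
      rwa [h0] at this
  exact hanti2 (left_mem_Icc.2 zero_le_one) (right_mem_Icc.2 zero_le_one) zero_le_one

variable {n : ℕ} {c : Euc n → Euc n → ℝ} {U V : Set (Euc n)}

lemma xOf_left (hB1 : B1cond n c U V) {x ybar : Euc n} (hx : x ∈ closure U)
    (hy : ybar ∈ closure V) : xOf n c U ybar (-gradY n c x ybar) = x :=
  (hB1.1 ybar hy).1.leftInvOn_invFunOn hx

lemma xOf_reg (hB0 : B0cond n c U V) (hB1 : B1cond n c U V) {x ybar : Euc n} (hx : x ∈ U)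
    (hy : ybar ∈ V) : ContDiffAt ℝ (3 : ℕ) (xOf n c U ybar) (-gradY n c x ybar) := by
  obtain ⟨hinj, -, hg⟩ := hB1.1 ybar (subset_closure hy)
  exact (inv_nhds hinj hg (mem_of_superset (hB0.1.mem_nhds hx) subset_closure) (by norm_num)
    (negGradY_contDiffAt hB0 hx hy)).1

/-- A curve in `V` that is a segment in cost coordinates at `x0`. -/
lemma seg_curve (hB0 : B0cond n c U V) (hB1 : B1cond n c U V) (hB2 : B2cond n c U V)
    {x0 y0 y1 : Euc n} (hx : x0 ∈ U) (hy0 : y0 ∈ V) (hy1 : y1 ∈ V) :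
    ∃ Y : ℝ → Euc n, Y 0 = y0 ∧ Y 1 = y1 ∧ ∀ t ∈ Icc (0 : ℝ) 1, Y t ∈ V ∧
      ContDiffAt ℝ (3 : ℕ) Y t ∧ gradX n c x0 (Y t) =
        gradX n c x0 y0 + t • (gradX n c x0 y1 - gradX n c x0 y0) := by
  obtain ⟨hinj, -, hg⟩ := hB1.2 x0 (subset_closure hx)
  set f : Euc n → Euc n := fun y => -gradX n c x0 y with hf
  set g := Function.invFunOn f (closure V) with hgdef
  have hgf : ∀ z ∈ closure V, g (f z) = z := fun z hz => hinj.leftInvOn_invFunOn hz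
  have hconv := hB2.2 x0 (subset_closure hx)
  refine ⟨fun t => g (f y0 + t • (f y1 - f y0)), ?_, ?_, ?_⟩
  · simpa using hgf y0 (subset_closure hy0)
  · simpa using hgf y1 (subset_closure hy1)
  · intro t ht
    have hmem : f y0 + t • (f y1 - f y0) ∈ f '' V :=
      hconv.add_smul_sub_mem (mem_image_of_mem f hy0) (mem_image_of_mem f hy1) ht
    obtain ⟨z, hz, hzt⟩ := hmem
    have hgz : g (f y0 + t • (f y1 - f y0)) = z := by
      rw [← hzt]; exact hgf z (subset_closure hz)
    refine ⟨by simp only [hgz]; exact hz, ?_, ?_⟩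
    · have hC : ContDiffAt ℝ (3 : ℕ) g (f z) :=
        (inv_nhds hinj hg (mem_of_superset (hB0.2.2.1.mem_nhds hz) subset_closure) (by norm_num)
          (gradX_y_contDiffAt hB0 hx hz).neg).1
      refine ContDiffAt.comp (g := g) (f := fun t : ℝ => f y0 + t • (f y1 - f y0)) t ?_ (by fun_prop)
      rw [← hzt]; exact hC
    · simp only [hgz]
      have h1 : gradX n c x0 z = - f z := by simp [hf]
      rw [h1, hzt]
      simp only [hf]
      module

lemma hess_main (hB0 : B0cond n c U V) (hB1 : B1cond n c U V) (hB2 : B2cond n c U V)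
    (hB3 : B3cond n c U V) {x0 y ybar e : Euc n} (hx0 : x0 ∈ U) (hy : y ∈ V) (hyb : ybar ∈ V)
    (m : Euc n → ℝ) (hm : m = fun q => -c (xOf n c U ybar q) y + c (xOf n c U ybar q) ybar) :
    ContDiffAt ℝ (2 : ℕ) m (-gradY n c x0 ybar) ∧
    (ddir e m (-gradY n c x0 ybar) = 0 → 0 ≤ ddir e (ddir e m) (-gradY n c x0 ybar)) := by
  set F := Function.uncurry c with hFdef
  set q0 := -gradY n c x0 ybar with hq0
  set X := xOf n c U ybar with hX
  have hXq : X q0 = x0 := xOf_left hB1 (subset_closure hx0) (subset_closure hyb)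
  have hXC : ContDiffAt ℝ (3 : ℕ) X q0 := xOf_reg hB0 hB1 hx0 hyb
  have hFX : ∀ y ∈ V, ContDiffAt ℝ (3 : ℕ) (fun q => F (X q, y)) q0 := by
    intro y hy
    refine ContDiffAt.comp (g := F) (f := fun q => (X q, y)) q0 ?_ (hXC.prodMk contDiffAt_const)
    rw [hXq]; exact (cost_reg hB0 hx0 hy).of_le (by norm_num)
  have hmC : ContDiffAt ℝ (2 : ℕ) m q0 := by
    rw [hm]
    exact (((hFX y hy).neg).add (hFX ybar hyb)).of_le (by norm_num)
  refine ⟨hmC, fun he => ?_⟩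
  -- the line and the curve
  set l : ℝ → Euc n := fun s => q0 + s • e with hl
  have hl0 : l 0 = q0 := by simp [hl]
  have hlC : ContDiffAt ℝ (3 : ℕ) l 0 := by fun_prop
  have hld : ∀ s, HasDerivAt l e s := by
    intro s
    have := ((hasDerivAt_id s).smul_const e).const_add q0
    rw [one_smul] at this
    exact this
  have hld1 : deriv l = fun _ => e := funext fun s => (hld s).deriv
  have hld2 : deriv (deriv l) 0 = 0 := by rw [hld1]; simp
  set xc : ℝ → Euc n := fun s => X (l s) with hxc
  have hxcC : ContDiffAt ℝ (2 : ℕ) xc 0 := by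
    refine ContDiffAt.of_le (n := (3 : ℕ)) ?_ (by norm_num)
    exact ContDiffAt.comp (g := X) (f := l) 0 (by rw [hl0]; exact hXC) hlC
  have hxc0 : xc 0 = x0 := by simp only [hxc, hl0, hXq]
  set ξ := deriv xc 0 with hξ
  set χ := deriv (deriv xc) 0 with hχ
  have hF4 : ∀ y ∈ V, ContDiffAt ℝ (4 : ℕ) F (x0, y) := fun y hy => cost_reg hB0 hx0 hy
  have hcx : ∀ {f : Euc n × Euc n → ℝ} {y : Euc n}, ContDiffAt ℝ (2 : ℕ) f (x0, y) →
      ContDiffAt ℝ (2 : ℕ) (fun s => f (xc s, y)) 0 := by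
    intro f y hf
    refine ContDiffAt.comp (g := f) (f := fun s => (xc s, y)) 0 ?_ (hxcC.prodMk contDiffAt_const)
    rw [hxc0]; exact hf
  have e1 : ∀ {f : Euc n × Euc n → ℝ} {y : Euc n}, ContDiffAt ℝ (2 : ℕ) f (x0, y) →
      deriv (deriv (fun s => f (xc s, y))) 0 =
        ddir (ξ, 0) (ddir (ξ, 0) f) (x0, y) + ddir (χ, 0) f (x0, y) := by
    intro f y hf
    have := (d2x (f := f) (y := y) (xc := xc) (t := 0) (by rw [hxc0]; exact hf) hxcC).deriv
    rw [hxc0] at this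
    exact this
  -- first derivative
  have hml : (fun s => m (l s)) = fun s => F (xc s, ybar) - F (xc s, y) := by
    ext1 s
    simp only [hm, hxc, hFdef, Function.uncurry]; ring
  have hort : inner ℝ (gradX n c x0 y - gradX n c x0 ybar) ξ = 0 := by
    have h1 := (deriv_along (f := m) (α := l) (t := 0)
      (by rw [hl0]; exact hmC.differentiableAt (by norm_num)) (hld 0).differentiableAt).deriv
    rw [hml, hld1] at h1
    simp only [hl0] at h1
    rw [he] at h1
    have hdx : ∀ y ∈ V, HasDerivAt (fun s => F (xc s, y)) (inner ℝ (gradX n c x0 y) ξ) 0 := by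
      intro y hy
      have := d1x (f := F) (y := y) (xc := xc) (t := 0)
        (by rw [hxc0]; exact (hF4 y hy).differentiableAt (by norm_num))
        (hxcC.differentiableAt (by norm_num))
      rw [hxc0, ← gradX_inner ((hF4 y hy).differentiableAt (by norm_num))] at this
      exact this
    have h2 := ((hdx ybar hyb).sub (hdx y hy)).deriv
    change deriv (fun s => F (xc s, ybar) - F (xc s, y)) 0 = _ at h2
    rw [h1] at h2
    rw [inner_sub_left]; linarith
  -- second derivative
  have h2nd : ddir e (ddir e m) q0 = (ddir (ξ, 0) (ddir (ξ, 0) F) (x0, ybar) +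
      ddir (χ, 0) F (x0, ybar)) - (ddir (ξ, 0) (ddir (ξ, 0) F) (x0, y) +
      ddir (χ, 0) F (x0, y)) := by
    have h1 := (deriv2_along (f := m) (α := l) (t := 0) (by rw [hl0]; exact hmC)
      (hlC.of_le (by norm_num))).deriv
    rw [hml, hld2, hld1, hl0, deriv2_sub (hcx ((hF4 ybar hyb).of_le (by norm_num)))
      (hcx ((hF4 y hy).of_le (by norm_num))), e1 ((hF4 ybar hyb).of_le (by norm_num)),
      e1 ((hF4 y hy).of_le (by norm_num))] at h1
    rw [h1]; simp [ddir]
  rw [h2nd]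
  obtain ⟨Y, hY0, hY1, hY⟩ := seg_curve hB0 hB1 hB2 hx0 hyb hy
  set P1 : ℝ → ℝ := fun t => ddir (ξ, 0) (ddir (ξ, 0) F) (x0, Y t) with hP1
  set P2 : ℝ → ℝ := fun t => ddir (χ, 0) F (x0, Y t) with hP2
  have hJ1 : ∀ y ∈ V, ContDiffAt ℝ (2 : ℕ) (ddir (ξ, 0) (ddir (ξ, 0) F)) (x0, y) := fun y hy =>
    ddir_contDiffAt (ddir_contDiffAt (m := 3) (hF4 y hy) (by norm_num) _) (by norm_num) _
  have hJ2 : ∀ v, ∀ y ∈ V, ContDiffAt ℝ (2 : ℕ) (ddir v F) (x0, y) := fun v y hy =>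
    ddir_contDiffAt (hF4 y hy) (by norm_num) _
  have hcy : ∀ {f : Euc n × Euc n → ℝ}, (∀ y ∈ V, ContDiffAt ℝ (2 : ℕ) f (x0, y)) →
      ∀ t ∈ Icc (0 : ℝ) 1, ContDiffAt ℝ (2 : ℕ) (fun s => f (x0, Y s)) t := by
    intro f hf t ht
    exact ContDiffAt.comp (g := f) (f := fun s => (x0, Y s)) t (hf _ (hY t ht).1)
      (contDiffAt_const.prodMk ((hY t ht).2.1.of_le (by norm_num)))
  have hP1C := hcy hJ1
  have hP2C := hcy (hJ2 (χ, 0))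
  have hkey : P1 1 + P2 1 ≤ P1 0 + P2 0 := by
    apply one_dim_concave (P := fun t => P1 t + P2 t)
    · exact fun t ht => (hP1C t ht).add (hP2C t ht)
    · have h01 : (0 : ℝ) ∈ Icc (0 : ℝ) 1 := by norm_num
      set η := deriv Y 0 with hη
      have hYd : DifferentiableAt ℝ Y 0 := (hY 0 h01).2.1.differentiableAt (by norm_num)
      have k1 := d1y (f := ddir (ξ, 0) (ddir (ξ, 0) F)) (x := x0) (yc := Y) (t := 0)
        ((hJ1 _ (hY 0 h01).1).differentiableAt (by norm_num)) hYd
      have k2 := d1y (f := ddir (χ, 0) F) (x := x0) (yc := Y) (t := 0)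
        ((hJ2 _ _ (hY 0 h01).1).differentiableAt (by norm_num)) hYd
      have k3 := (k1.add k2).deriv
      change deriv (fun t => P1 t + P2 t) 0 = _ at k3
      rw [k3, hY0, ddir_comm3 ((hF4 ybar hyb).of_le (by norm_num)),
        ddir_comm ((hF4 ybar hyb).of_le (by norm_num)), ← e1 (hJ2 _ ybar hyb)]
      apply deriv2_affine (a := inner ℝ (-q0) η) (b := inner ℝ (-e) η)
      have hlU : ∀ᶠ s in 𝓝 (0 : ℝ), l s ∈ (fun x => -gradY n c x ybar) '' U := by
        obtain ⟨hinj, -, hg⟩ := hB1.1 ybar (subset_closure hyb)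
        have hmap := (inv_nhds hinj hg (mem_of_superset (hB0.1.mem_nhds hx0) subset_closure)
          (by norm_num) (negGradY_contDiffAt hB0 hx0 hyb)).2
        have himg : (fun x => -gradY n c x ybar) '' U ∈ 𝓝 (l 0) := by
          rw [hl0, hq0, hmap]; exact image_mem_map (hB0.1.mem_nhds hx0)
        exact hlC.continuousAt.eventually himg
      filter_upwards [hlU] with s hs
      obtain ⟨x, hxU, hxs⟩ := hs
      have hx' : xc s = x := by
        simp only [hxc]
        rw [← hxs]; exact xOf_left hB1 (subset_closure hxU) (subset_closure hyb)
      rw [hx', ← gradY_inner ((cost_reg hB0 hxU hyb).differentiableAt (by norm_num))]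
      have : gradY n c x ybar = -q0 + s • (-e) := by
        have h3 : gradY n c x ybar = -(l s) := by rw [← hxs]; simp
        rw [h3]; simp only [hl]; module
      rw [this, inner_add_left, real_inner_smul_left]
    · intro t ht
      have htI := Ioo_subset_Icc_self ht
      rw [deriv2_add (hP1C t htI) (hP2C t htI)]
      have hz : deriv (deriv P2) t = 0 := by
        apply deriv2_affine (a := inner ℝ (gradX n c x0 ybar) χ)
          (b := inner ℝ (gradX n c x0 y - gradX n c x0 ybar) χ)
        filter_upwards [Icc_mem_nhds ht.1 ht.2] with s hs
        simp only [hP2]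
        rw [← gradX_inner ((hF4 _ (hY s hs).1).differentiableAt (by norm_num)), (hY s hs).2.2,
          inner_add_left, real_inner_smul_left]
      set μ := min t (1 - t) with hμ
      have hμ0 : 0 < μ := lt_min ht.1 (by linarith [ht.2])
      have hμ1 : μ ≤ t := min_le_left _ _
      have hμ2 : μ ≤ 1 - t := min_le_right _ _
      have hin : ∀ τ ∈ Icc (-1 : ℝ) 1, t + μ * τ ∈ Icc (0 : ℝ) 1 := by
        intro τ hτ
        constructor <;> nlinarith [hτ.1, hτ.2]
      have ha3 := a3_local hB0 hB1 hB3 hx0 (yc := fun τ => Y (t + μ * τ))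
        (a := gradX n c x0 ybar + t • (gradX n c x0 y - gradX n c x0 ybar))
        (b := μ • (gradX n c x0 y - gradX n c x0 ybar)) (ξ := ξ)
        (fun τ hτ => (hY _ (hin τ hτ)).1) ?_ ?_ ?_
      · have hr := deriv2_rescale P1 t μ
        rw [hz, add_zero]
        simp only [hP1] at hr ⊢
        rw [hr] at ha3
        by_contra hcon
        push Not at hcon
        have := mul_pos (pow_pos hμ0 2) hcon
        linarith
      · refine ContDiffAt.comp (g := Y) (f := fun τ : ℝ => t + μ * τ) 0 ?_ (by fun_prop)
        rw [mul_zero, add_zero]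
        exact (hY t htI).2.1.of_le (by norm_num)
      · intro τ hτ
        rw [(hY _ (hin τ hτ)).2.2]; module
      · rw [real_inner_smul_left, hort, mul_zero]
  simp only [hP1, hP2, hY0, hY1] at hkey
  linarith

end P6

section P7
open Filter Topology

variable {n : ℕ} {c : Euc n → Euc n → ℝ} {U V : Set (Euc n)}

/-- Gradient of `-c̃(·,y)` in the cost-exponential coordinates, at the point of parameter `x`. -/
noncomputable def vecC (n : ℕ) (c : Euc n → Euc n → ℝ) (x y ybar : Euc n) : Euc n :=
  ContinuousLinearMap.adjoint (DxyC n c x ybar).inverse (gradX n c x y - gradX n c x ybar)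

lemma vecC_inner (x y ybar e : Euc n) : inner ℝ (vecC n c x y ybar) e =
    inner ℝ (gradX n c x y - gradX n c x ybar) ((DxyC n c x ybar).inverse e) := by
  unfold vecC; rw [ContinuousLinearMap.adjoint_inner_left]

lemma Dxy_equiv (hB0 : B0cond n c U V) (hB1 : B1cond n c U V) {x y : Euc n} (hx : x ∈ U)
    (hy : y ∈ closure V) : DifferentiableAt ℝ (fun x => gradY n c x y) x ∧
    ∃ A : Euc n ≃L[ℝ] Euc n, DxyC n c x y = A ∧ (DxyC n c x y).inverse = A.symm := by
  obtain ⟨hinj, hf, hg⟩ := hB1.1 y hy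
  have hcl : closure U ∈ 𝓝 x := mem_of_superset (hB0.1.mem_nhds hx) subset_closure
  have hd : DifferentiableAt ℝ (fun x => -gradY n c x y) x :=
    (hf.contDiffAt hcl).differentiableAt (by norm_num)
  have hd' : DifferentiableAt ℝ (fun x => gradY n c x y) x := by
    have := hd.neg
    simpa using this
  refine ⟨hd', ?_⟩
  obtain ⟨e, he⟩ := inv_fderiv hinj hg hcl hd
  have hA : DxyC n c x y = ((e.trans (ContinuousLinearEquiv.neg ℝ) : Euc n ≃L[ℝ] Euc n) :
      Euc n →L[ℝ] Euc n) := by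
    ext1 v
    have h1 : (e : Euc n →L[ℝ] Euc n) v = -(DxyC n c x y v) := by
      rw [he, fderiv_fun_neg]; rfl
    have h2 : DxyC n c x y v = -(e v) := by
      change _ = -((e : Euc n →L[ℝ] Euc n) v)
      rw [h1, neg_neg]
    rw [h2]; simp
  exact ⟨_, hA, by rw [hA, ContinuousLinearMap.inverse_equiv]⟩

lemma xOf_hasFDerivAt (hB0 : B0cond n c U V) (hB1 : B1cond n c U V) {x ybar : Euc n}
    (hx : x ∈ U) (hy : ybar ∈ closure V) :
    HasFDerivAt (xOf n c U ybar) (-(DxyC n c x ybar).inverse) (-gradY n c x ybar) := by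
  obtain ⟨hinj, hf, hg⟩ := hB1.1 ybar hy
  have hcl : closure U ∈ 𝓝 x := mem_of_superset (hB0.1.mem_nhds hx) subset_closure
  obtain ⟨hgC, -⟩ := inv_nhds (k := 1) hinj hg hcl le_rfl (hf.contDiffAt hcl)
  obtain ⟨hd, A, hA, hAi⟩ := Dxy_equiv hB0 hB1 hx hy
  have hgd : HasFDerivAt (xOf n c U ybar) (fderiv ℝ (xOf n c U ybar) (-gradY n c x ybar))
      (-gradY n c x ybar) := (hgC.differentiableAt (by norm_num)).hasFDerivAt
  have hfd : HasFDerivAt (fun x => -gradY n c x ybar) (-(DxyC n c x ybar)) x :=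
    hd.hasFDerivAt.neg
  have hcomp := HasFDerivAt.comp (g := xOf n c U ybar) (f := fun x => -gradY n c x ybar) x hgd hfd
  have hid : HasFDerivAt (fun z : Euc n => z)
      ((fderiv ℝ (xOf n c U ybar) (-gradY n c x ybar)).comp (-(DxyC n c x ybar))) x := by
    refine hcomp.congr_of_eventuallyEq ?_
    filter_upwards [hcl] with z hz
    exact (xOf_left hB1 hz hy).symm
  have hu := hid.unique (hasFDerivAt_id x)
  have hfin : fderiv ℝ (xOf n c U ybar) (-gradY n c x ybar) = -(DxyC n c x ybar).inverse := by
    ext1 v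
    have h1 := DFunLike.congr_fun hu (A.symm v)
    rw [hA] at h1
    simp at h1
    rw [hAi]
    simp only [neg_apply, ContinuousLinearEquiv.coe_coe]
    rw [← h1, neg_neg]
  rw [← hfin]; exact hgd

lemma cost_x_diff (hB0 : B0cond n c U V) {x y : Euc n} (hx : x ∈ U) (hy : y ∈ closure V) :
    DifferentiableAt ℝ (fun x => c x y) x := by
  obtain ⟨hU, -, hV, -, hc⟩ := hB0
  have h1 : DifferentiableWithinAt ℝ (Function.uncurry c) (closure U ×ˢ closure V) (x, y) :=
    (hc (x, y) ⟨subset_closure hx, hy⟩).differentiableWithinAt (by norm_num)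
  have h2 : DifferentiableWithinAt ℝ (fun x' => Function.uncurry c (x', y)) (closure U) x :=
    DifferentiableWithinAt.comp (g := Function.uncurry c) (f := fun x' : Euc n => (x', y)) x h1
      (by fun_prop) (fun z hz => ⟨hz, hy⟩)
  exact h2.differentiableAt (mem_of_superset (hU.mem_nhds hx) subset_closure)

lemma m_hasFDerivAt (hB0 : B0cond n c U V) (hB1 : B1cond n c U V) {x y ybar : Euc n}
    (hx : x ∈ U) (hy : y ∈ closure V) (hyb : ybar ∈ closure V) :
    HasFDerivAt (fun q => -c (xOf n c U ybar q) y + c (xOf n c U ybar q) ybar)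
      (InnerProductSpace.toDual ℝ (Euc n) (vecC n c x y ybar)) (-gradY n c x ybar) := by
  have hX := xOf_hasFDerivAt hB0 hB1 hx hyb
  have hXq := xOf_left hB1 (subset_closure hx) hyb
  have hd : ∀ y ∈ closure V, HasFDerivAt (fun q => c (xOf n c U ybar q) y)
      ((InnerProductSpace.toDual ℝ (Euc n) (gradX n c x y)).comp (-(DxyC n c x ybar).inverse))
      (-gradY n c x ybar) := by
    intro y hy
    refine HasFDerivAt.comp (g := fun x => c x y) (f := xOf n c U ybar) _ ?_ hX
    rw [hXq]
    exact (cost_x_diff hB0 hx hy).hasGradientAt.hasFDerivAt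
  have := (hd y hy).neg.add (hd ybar hyb)
  suffices hL : InnerProductSpace.toDual ℝ (Euc n) (vecC n c x y ybar) =
      -((InnerProductSpace.toDual ℝ (Euc n) (gradX n c x y)).comp (-(DxyC n c x ybar).inverse)) +
      (InnerProductSpace.toDual ℝ (Euc n) (gradX n c x ybar)).comp
        (-(DxyC n c x ybar).inverse) by
    rw [hL]; exact this
  ext1 v
  simp only [InnerProductSpace.toDual_apply_apply, vecC_inner]
  simp [inner_sub_left]
  ring

lemma vecC_ne_zero (hB0 : B0cond n c U V) (hB1 : B1cond n c U V) {x y ybar : Euc n}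
    (hx : x ∈ U) (hy : y ∈ closure V) (hyb : ybar ∈ closure V) (hne : y ≠ ybar) :
    vecC n c x y ybar ≠ 0 := by
  intro h0
  obtain ⟨hd, A, hA, hAi⟩ := Dxy_equiv hB0 hB1 hx hyb
  apply hne
  apply (hB1.2 x (subset_closure hx)).1 hy hyb
  simp only
  congr 1
  rw [← sub_eq_zero]
  apply ext_inner_right ℝ
  intro v
  have := vecC_inner (c := c) x y ybar (A v)
  rw [h0, hAi] at this
  simpa using this.symm

/-- Quasi-convexity (interior version). -/
lemma qc_int (hB0 : B0cond n c U V) (hB1 : B1cond n c U V) (hB2 : B2cond n c U V)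
    (hB3 : B3cond n c U V) {x w y ybar : Euc n} (hx : x ∈ U) (hw : w ∈ U) (hy : y ∈ V)
    (hyb : ybar ∈ V)
    (hpos : 0 < inner ℝ (vecC n c x y ybar) (-gradY n c w ybar - -gradY n c x ybar)) :
    -c x y + c x ybar ≤ -c w y + c w ybar := by
  have hcy := subset_closure hy
  have hcyb := subset_closure hyb
  have hne : y ≠ ybar := by
    rintro rfl
    simp [vecC] at hpos
  have h := quasi_of_hess (O := Uyset n c U ybar)
    (m := fun q => -c (xOf n c U ybar q) y + c (xOf n c U ybar q) ybar)
    (hB2.1 ybar hcyb) ?_ ?_ ?_ (p := -gradY n c x ybar) (w := -gradY n c w ybar)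
    (mem_image_of_mem _ hx) (mem_image_of_mem _ hw) ?_
  · simp only [xOf_left hB1 (subset_closure hx) hcyb, xOf_left hB1 (subset_closure hw) hcyb] at h
    exact h
  · rintro _ ⟨x, hx, rfl⟩
    exact (hess_main (e := 0) hB0 hB1 hB2 hB3 hx hy hyb _ rfl).1
  · rintro _ ⟨x, hx, rfl⟩
    rw [(m_hasFDerivAt hB0 hB1 hx hcy hcyb).fderiv]
    simpa using vecC_ne_zero hB0 hB1 hx hcy hcyb hne
  · rintro _ ⟨x, hx, rfl⟩ e
    exact (hess_main hB0 hB1 hB2 hB3 hx hy hyb _ rfl).2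
  · unfold ddir
    rw [(m_hasFDerivAt hB0 hB1 hx hcy hcyb).fderiv]
    simpa using hpos

end P7

section P8
open Filter Topology

variable {n : ℕ} {c : Euc n → Euc n → ℝ} {U V : Set (Euc n)}

lemma gradX_curve_deriv (hB0 : B0cond n c U V) {x : Euc n} (hx : x ∈ U) {Y : ℝ → Euc n} {t : ℝ}
    (hYt : Y t ∈ V) (hYd : DifferentiableAt ℝ Y t) (v : Euc n) :
    HasDerivAt (fun s => inner ℝ (gradX n c x (Y s)) v) (inner ℝ (DxyC n c x (Y t) v) (deriv Y t))
      t := by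
  have hF := cost_reg hB0 hx hYt
  have h1 := d1y (f := ddir (v, 0) (Function.uncurry c)) (x := x) (yc := Y) (t := t)
    ((ddir_contDiffAt (m := 3) hF (by norm_num) _).differentiableAt (by norm_num)) hYd
  rw [ddir_comm (hF.of_le (by norm_num)), ← Dxy_inner hB0 hx hYt] at h1
  refine h1.congr_of_eventuallyEq ?_
  have hc : ContinuousAt (fun s => (x, Y s)) t := continuousAt_const.prodMk hYd.continuousAt
  filter_upwards [hc.eventually (hF.eventually (by simp))] with s hs
  exact gradX_inner (hs.differentiableAt (by norm_num)) v

lemma Dxy_lip (hB0 : B0cond n c U V) (hB1 : B1cond n c U V) (hB2 : B2cond n c U V)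
    {bm D : ℝ} (hbm : ∀ x ∈ U, ∀ y ∈ V, ‖(DxyC n c x y).inverse‖ ≤ bm)
    (hD : ∀ x ∈ U, ∀ y ∈ V, ‖DxxyC n c x y‖ ≤ D)
    {x x' y ybar : Euc n} (hx : x ∈ U) (hx' : x' ∈ U) (hy : y ∈ V) (hyb : ybar ∈ V) :
    ‖DxyC n c x y - DxyC n c x' y‖ ≤ D * bm * ‖-gradY n c x ybar - -gradY n c x' ybar‖ := by
  have hcyb := subset_closure hyb
  have hder : ∀ q ∈ Uyset n c U ybar, HasFDerivWithinAt (fun q => DxyC n c (xOf n c U ybar q) y)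
      ((DxxyC n c (xOf n c U ybar q) y).comp (-(DxyC n c (xOf n c U ybar q) ybar).inverse))
      (Uyset n c U ybar) q := by
    rintro _ ⟨z, hz, rfl⟩
    have hX := xOf_hasFDerivAt hB0 hB1 hz hcyb
    have hXq := xOf_left hB1 (subset_closure hz) hcyb
    simp only [hXq]
    apply HasFDerivAt.hasFDerivWithinAt
    refine HasFDerivAt.comp (g := fun x => DxyC n c x y) (f := xOf n c U ybar) _ ?_ hX
    rw [hXq]
    have h1 : ContDiffAt ℝ (2 : ℕ) (fderiv ℝ (fun x' => gradY n c x' y)) z :=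
      (gradY_x_contDiffAt hB0 hz hy).fderiv_right (by norm_num)
    exact (h1.differentiableAt (by norm_num)).hasFDerivAt
  have hbound : ∀ q ∈ Uyset n c U ybar, ‖(DxxyC n c (xOf n c U ybar q) y).comp
      (-(DxyC n c (xOf n c U ybar q) ybar).inverse)‖ ≤ D * bm := by
    rintro _ ⟨z, hz, rfl⟩
    have hXq := xOf_left hB1 (subset_closure hz) hcyb
    simp only [hXq]
    refine (ContinuousLinearMap.opNorm_comp_le _ _).trans ?_
    rw [norm_neg]
    exact mul_le_mul (hD z hz y hy) (hbm z hz ybar hyb) (norm_nonneg _)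
      ((norm_nonneg (DxxyC n c z y)).trans (hD z hz y hy))
  have := (hB2.1 ybar hcyb).norm_image_sub_le_of_norm_hasFDerivWithin_le hder hbound
    (mem_image_of_mem _ hx') (mem_image_of_mem _ hx)
  simp only [xOf_left hB1 (subset_closure hx) hcyb, xOf_left hB1 (subset_closure hx') hcyb] at this
  exact this

set_option maxHeartbeats 2000000 in
lemma lip_int (hB0 : B0cond n c U V) (hB1 : B1cond n c U V) (hB2 : B2cond n c U V)
    {bp bm D : ℝ} (hbp : ∀ x ∈ U, ∀ y ∈ V, ‖DxyC n c x y‖ ≤ bp)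
    (hbm : ∀ x ∈ U, ∀ y ∈ V, ‖(DxyC n c x y).inverse‖ ≤ bm)
    (hD : ∀ x ∈ U, ∀ y ∈ V, ‖DxxyC n c x y‖ ≤ D) (h1 : 1 ≤ bp * bm)
    {x x' y ybar : Euc n} (hx : x ∈ U) (hx' : x' ∈ U) (hy : y ∈ V) (hyb : ybar ∈ V) :
    ‖vecC n c x y ybar - vecC n c x' y ybar‖ ≤ (2 * bp ^ 4 * bm ^ 6 * D) *
      ‖-gradY n c x ybar - -gradY n c x' ybar‖ * ‖vecC n c x' y ybar‖ := by
  have hbp0 : 0 ≤ bp := (norm_nonneg _).trans (hbp x hx y hy)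
  have hbm0 : 0 ≤ bm := (norm_nonneg _).trans (hbm x hx y hy)
  have hD0 : 0 ≤ D := (norm_nonneg (DxxyC n c x y)).trans (hD x hx y hy)
  set Δ := ‖-gradY n c x ybar - -gradY n c x' ybar‖ with hΔ
  have hΔ0 : 0 ≤ Δ := norm_nonneg _
  set W := ‖vecC n c x' y ybar‖ with hW
  have hW0 : 0 ≤ W := norm_nonneg _
  obtain ⟨Y, hY0, hY1, hY⟩ := seg_curve hB0 hB1 hB2 hx' hyb hy
  set d := gradX n c x' y - gradX n c x' ybar with hd
  obtain ⟨-, B1, hB1', hB1i⟩ := Dxy_equiv hB0 hB1 hx (subset_closure hyb)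
  obtain ⟨-, B2, hB2', hB2i⟩ := Dxy_equiv hB0 hB1 hx' (subset_closure hyb)
  have hdn : ‖d‖ ≤ bp * W := by
    have h2 := vecC_inner (c := c) x' y ybar (DxyC n c x' ybar d)
    have h3 : (DxyC n c x' ybar).inverse (DxyC n c x' ybar d) = d := by
      rw [hB2i, hB2']; simp
    rw [h3, real_inner_self_eq_norm_sq] at h2
    have h4 := real_inner_le_norm (vecC n c x' y ybar) (DxyC n c x' ybar d)
    have h5 := ((DxyC n c x' ybar).le_opNorm d).trans
      (mul_le_mul_of_nonneg_right (hbp x' hx' ybar hyb) (norm_nonneg d))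
    have h6 : ‖d‖ ^ 2 ≤ W * (bp * ‖d‖) := by
      rw [← h2]; exact h4.trans (mul_le_mul_of_nonneg_left h5 hW0)
    by_cases h0 : ‖d‖ = 0
    · rw [h0]; positivity
    · have : 0 < ‖d‖ := lt_of_le_of_ne (norm_nonneg _) (Ne.symm h0)
      nlinarith
  have hYd : ∀ t ∈ Icc (0 : ℝ) 1, ‖deriv Y t‖ ≤ bm * (bp * W) := by
    intro t ht
    obtain ⟨hYV, hYC, -⟩ := hY t ht
    obtain ⟨-, A2, hA2, hA2i⟩ := Dxy_equiv hB0 hB1 hx' (subset_closure hYV)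
    have hk : ∀ v, inner ℝ (DxyC n c x' (Y t) v) (deriv Y t) = inner ℝ d v := by
      intro v
      have k1 := (gradX_curve_deriv hB0 hx' hYV (hYC.differentiableAt (by norm_num)) v)
      have k2 : HasDerivAt (fun s : ℝ => inner ℝ (gradX n c x' ybar) v + s * inner ℝ d v)
          (inner ℝ d v) t := by
        have := ((hasDerivAt_id t).mul_const (inner ℝ d v)).const_add
          (inner ℝ (gradX n c x' ybar) v)
        rw [one_mul] at this
        exact this
      have k3 : HasDerivWithinAt (fun s => inner ℝ (gradX n c x' (Y s)) v) (inner ℝ d v)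
          (Icc 0 1) t := by
        refine k2.hasDerivWithinAt.congr_of_mem ?_ ht
        intro s hs
        rw [(hY s hs).2.2, inner_add_left, real_inner_smul_left]
      exact ((uniqueDiffOn_Icc zero_lt_one) t ht).eq_deriv _ k1.hasDerivWithinAt k3
    have h2 := hk ((DxyC n c x' (Y t)).inverse (deriv Y t))
    have h3 : DxyC n c x' (Y t) ((DxyC n c x' (Y t)).inverse (deriv Y t)) = deriv Y t := by
      rw [hA2i, hA2]; simp
    rw [h3, real_inner_self_eq_norm_sq] at h2
    have h4 := real_inner_le_norm d ((DxyC n c x' (Y t)).inverse (deriv Y t))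
    have h5 := ((DxyC n c x' (Y t)).inverse.le_opNorm (deriv Y t)).trans
      (mul_le_mul_of_nonneg_right (hbm x' hx' _ hYV) (norm_nonneg _))
    have h6 : ‖deriv Y t‖ ^ 2 ≤ (bp * W) * (bm * ‖deriv Y t‖) := by
      rw [h2]
      exact h4.trans (mul_le_mul hdn h5 (norm_nonneg _) (by positivity))
    by_cases h0 : ‖deriv Y t‖ = 0
    · rw [h0]; positivity
    · have : 0 < ‖deriv Y t‖ := lt_of_le_of_ne (norm_nonneg _) (Ne.symm h0)
      nlinarith
  -- the difference of the conjugated mixed derivatives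
  have hM : ∀ y1 ∈ V, ∀ e : Euc n, ‖DxyC n c x y1 ((DxyC n c x ybar).inverse e) -
      DxyC n c x' y1 ((DxyC n c x' ybar).inverse e)‖ ≤
      (D * bm * Δ * bm + bp * (bm * (D * bm * Δ * bm))) * ‖e‖ := by
    intro y1 hy1 e
    have hs : DxyC n c x y1 ((DxyC n c x ybar).inverse e) -
      DxyC n c x' y1 ((DxyC n c x' ybar).inverse e) =
      (DxyC n c x y1 - DxyC n c x' y1) ((DxyC n c x ybar).inverse e) -
      DxyC n c x' y1 ((DxyC n c x' ybar).inverse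
        ((DxyC n c x ybar - DxyC n c x' ybar) ((DxyC n c x ybar).inverse e))) := by
      have h3 : DxyC n c x ybar ((DxyC n c x ybar).inverse e) = e := by
        rw [hB1i, hB1']; simp
      have h4 : ∀ v, (DxyC n c x' ybar).inverse (DxyC n c x' ybar v) = v := by
        intro v; rw [hB2i, hB2']; simp
      simp only [sub_apply, map_sub, h3, h4]
      abel
    have hi : ‖(DxyC n c x ybar).inverse e‖ ≤ bm * ‖e‖ :=
      (ContinuousLinearMap.le_opNorm _ _).trans
        (mul_le_mul_of_nonneg_right (hbm x hx ybar hyb) (norm_nonneg _))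
    have hj : ∀ y1 ∈ V, ‖(DxyC n c x y1 - DxyC n c x' y1) ((DxyC n c x ybar).inverse e)‖ ≤
        (D * bm * Δ) * (bm * ‖e‖) := fun y1 hy1 =>
      (ContinuousLinearMap.le_opNorm _ _).trans
        (mul_le_mul (Dxy_lip hB0 hB1 hB2 hbm hD hx hx' hy1 hyb) hi (norm_nonneg _)
          (by positivity))
    have hk : ‖(DxyC n c x' ybar).inverse ((DxyC n c x ybar - DxyC n c x' ybar)
        ((DxyC n c x ybar).inverse e))‖ ≤ bm * ((D * bm * Δ) * (bm * ‖e‖)) :=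
      (ContinuousLinearMap.le_opNorm _ _).trans
        (mul_le_mul (hbm x' hx' ybar hyb) (hj ybar hyb) (norm_nonneg _) hbm0)
    have hl := ((DxyC n c x' y1).le_opNorm _).trans
        (mul_le_mul (hbp x' hx' y1 hy1) hk (norm_nonneg _) hbp0)
    rw [hs]
    refine (norm_sub_le _ _).trans ((add_le_add (hj y1 hy1) hl).trans (le_of_eq ?_))
    ring
  set C := (D * bm * Δ * bm + bp * (bm * (D * bm * Δ * bm))) with hC
  have hC0 : 0 ≤ C := by positivity
  have hkey : ∀ e, inner ℝ (vecC n c x y ybar - vecC n c x' y ybar) e ≤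
      C * (bm * (bp * W)) * ‖e‖ := by
    intro e
    set ψ : ℝ → ℝ := fun t => inner ℝ (gradX n c x (Y t)) ((DxyC n c x ybar).inverse e) -
      inner ℝ (gradX n c x' (Y t)) ((DxyC n c x' ybar).inverse e) with hψ
    have hψd : ∀ t ∈ Icc (0 : ℝ) 1, HasDerivAt ψ
        (inner ℝ (DxyC n c x (Y t) ((DxyC n c x ybar).inverse e) -
      DxyC n c x' (Y t) ((DxyC n c x' ybar).inverse e)) (deriv Y t)) t := by
      intro t ht
      obtain ⟨hYV, hYC, -⟩ := hY t ht
      have hYD := hYC.differentiableAt (by norm_num)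
      rw [inner_sub_left]
      exact (gradX_curve_deriv hB0 hx hYV hYD _).sub (gradX_curve_deriv hB0 hx' hYV hYD _)
    have hb := norm_image_sub_le_of_norm_deriv_le_segment_01' (f := ψ)
      (C := C * (bm * (bp * W)) * ‖e‖) (fun t ht => (hψd t ht).hasDerivWithinAt) (by
        intro t ht
        have ht' := Ico_subset_Icc_self ht
        rw [Real.norm_eq_abs]
        refine (abs_real_inner_le_norm _ _).trans ?_
        refine (mul_le_mul (hM _ (hY t ht').1 e) (hYd t ht') (norm_nonneg _)
          (by positivity)).trans (le_of_eq ?_)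
        ring)
    have he : ψ 1 - ψ 0 = inner ℝ (vecC n c x y ybar - vecC n c x' y ybar) e := by
      rw [inner_sub_left, vecC_inner, vecC_inner]
      simp only [hψ, hY0, hY1, inner_sub_left]; ring
    rw [he] at hb
    exact (le_abs_self _).trans hb
  have hfin : ‖vecC n c x y ybar - vecC n c x' y ybar‖ ≤ C * (bm * (bp * W)) := by
    have := hkey (vecC n c x y ybar - vecC n c x' y ybar)
    rw [real_inner_self_eq_norm_sq] at this
    clear hkey hM hYd hY
    by_cases h0 : ‖vecC n c x y ybar - vecC n c x' y ybar‖ = 0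
    · rw [h0]; positivity
    · have h00 : 0 < ‖vecC n c x y ybar - vecC n c x' y ybar‖ :=
        lt_of_le_of_ne (norm_nonneg _) (Ne.symm h0)
      rw [sq] at this
      exact le_of_mul_le_mul_right this h00
  refine hfin.trans ?_
  have hs2 : 1 ≤ (bp * bm) ^ 3 := one_le_pow₀ h1
  have hs1 : 1 ≤ (bp * bm) ^ 2 := one_le_pow₀ h1
  have hs0 : (0:ℝ) ≤ D * Δ * W * bm ^ 2 := by positivity
  have e1 : C * (bm * (bp * W)) = (D * Δ * W * bm ^ 2) * ((bp * bm) + (bp * bm) ^ 2) := by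
    rw [hC]; ring
  have e2 : 2 * bp ^ 4 * bm ^ 6 * D * Δ * W = (D * Δ * W * bm ^ 2) * (2 * (bp * bm) ^ 4) := by
    ring
  rw [e1, e2]
  apply mul_le_mul_of_nonneg_left _ hs0
  set z := bp * bm with hz
  have e3 : z ^ 4 = z * z ^ 3 := by ring
  have e4 : z ^ 4 = z ^ 2 * z ^ 2 := by ring
  nlinarith

end P8

section P9
open Filter Topology

variable {n : ℕ} {c : Euc n → Euc n → ℝ} {U V : Set (Euc n)}

lemma uniqueDiff_clV (hB0 : B0cond n c U V) (hB1 : B1cond n c U V) (hB2 : B2cond n c U V)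
    {x0 : Euc n} (hx0 : x0 ∈ U) : UniqueDiffOn ℝ (closure V) := by
  intro y hy
  obtain ⟨hinj, hf, hg⟩ := hB1.2 x0 (subset_closure hx0)
  obtain ⟨v, hv⟩ : V.Nonempty := closure_nonempty_iff.1 ⟨y, hy⟩
  refine inv_uniqueDiff subset_closure hinj hf hg hy hy (hB2.2 x0 (subset_closure hx0)) ?_
  have hcl : closure V ∈ 𝓝 v := mem_of_superset (hB0.2.2.1.mem_nhds hv) subset_closure
  have hmap := (inv_nhds (k := 1) hinj hg hcl le_rfl (hf.contDiffAt hcl)).2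
  refine ⟨-gradX n c x0 v, mem_interior_iff_mem_nhds.2 ?_⟩
  rw [hmap]; exact image_mem_map (hB0.2.2.1.mem_nhds hv)

/-- Boundary representative of the second gradient. -/
noncomputable def Rrep (n : ℕ) (c : Euc n → Euc n → ℝ) (S : Set (Euc n × Euc n))
    (z : Euc n × Euc n) : Euc n :=
  (InnerProductSpace.toDual ℝ (Euc n)).symm
    ((fderivWithin ℝ (Function.uncurry c) S z).comp (ContinuousLinearMap.inr ℝ (Euc n) (Euc n)))

lemma Rrep_contDiffOn (hB0 : B0cond n c U V) (hB1 : B1cond n c U V) (hB2 : B2cond n c U V) :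
    UniqueDiffOn ℝ (U ×ˢ closure V) ∧
    ContDiffOn ℝ (3 : ℕ) (Rrep n c (U ×ˢ closure V)) (U ×ˢ closure V) := by
  have hS : UniqueDiffOn ℝ (U ×ˢ closure V) := by
    intro z hz
    exact (hB0.1.uniqueDiffOn.prod (uniqueDiff_clV hB0 hB1 hB2 hz.1)) z hz
  refine ⟨hS, ?_⟩
  have hc : ContDiffOn ℝ 4 (Function.uncurry c) (U ×ˢ closure V) :=
    hB0.2.2.2.2.mono (prod_mono subset_closure subset_rfl)
  have h1 : ContDiffOn ℝ (3 : ℕ) (fderivWithin ℝ (Function.uncurry c) (U ×ˢ closure V))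
    (U ×ˢ closure V) := hc.fderivWithin hS (by norm_num)
  have h2 : ContDiffOn ℝ (3 : ℕ) (fun z => (fderivWithin ℝ (Function.uncurry c)
    (U ×ˢ closure V) z).comp (ContinuousLinearMap.inr ℝ (Euc n) (Euc n))) (U ×ˢ closure V) :=
    h1.clm_comp contDiffOn_const
  exact (InnerProductSpace.toDual ℝ (Euc n)).symm.contDiff.comp_contDiffOn h2

lemma gradY_eq_Rrep_of_diff (hB0 : B0cond n c U V) (hB1 : B1cond n c U V) (hB2 : B2cond n c U V)
    {x y : Euc n} (hx : x ∈ U) (hy : y ∈ closure V) (hd : DifferentiableAt ℝ (fun y' => c x y') y) :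
    gradY n c x y = Rrep n c (U ×ˢ closure V) (x, y) := by
  unfold gradY gradient Rrep
  congr 1
  have hc : ContDiffOn ℝ 4 (Function.uncurry c) (U ×ˢ closure V) :=
    hB0.2.2.2.2.mono (prod_mono subset_closure subset_rfl)
  have h1 : HasFDerivWithinAt (Function.uncurry c)
      (fderivWithin ℝ (Function.uncurry c) (U ×ˢ closure V) (x, y)) (U ×ˢ closure V) (x, y) :=
    ((hc (x, y) ⟨hx, hy⟩).differentiableWithinAt (by norm_num)).hasFDerivWithinAt
  have h2 : HasFDerivWithinAt (fun y' => Function.uncurry c (x, y'))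
      ((fderivWithin ℝ (Function.uncurry c) (U ×ˢ closure V) (x, y)).comp
        (ContinuousLinearMap.inr ℝ (Euc n) (Euc n))) (closure V) y :=
    HasFDerivWithinAt.comp (g := Function.uncurry c) (f := fun y' : Euc n => (x, y')) y h1
      (hasFDerivAt_prodMk_right (𝕜 := ℝ) x y).hasFDerivWithinAt (fun z hz => ⟨hx, hz⟩)
  exact (uniqueDiff_clV hB0 hB1 hB2 hx y hy).eq hd.hasFDerivAt.hasFDerivWithinAt h2

lemma gradY_eq_Rrep [Nontrivial (Euc n)] (hB0 : B0cond n c U V) (hB1 : B1cond n c U V)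
    (hB2 : B2cond n c U V) {x y : Euc n} (hx : x ∈ U) (hy : y ∈ closure V) :
    gradY n c x y = Rrep n c (U ×ˢ closure V) (x, y) := by
  by_cases hd : DifferentiableAt ℝ (fun y' => c x y') y
  · exact gradY_eq_Rrep_of_diff hB0 hB1 hB2 hx hy hd
  have h0 : gradY n c x y = 0 := by
    unfold gradY gradient
    rw [fderiv_zero_of_not_differentiableAt hd]; simp
  have hev : ∀ᶠ x' in 𝓝[≠] x, gradY n c x' y = Rrep n c (U ×ˢ closure V) (x', y) := by
    have hU : ∀ᶠ x' in 𝓝[≠] x, x' ∈ U := nhdsWithin_le_nhds (hB0.1.mem_nhds hx)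
    filter_upwards [hU, self_mem_nhdsWithin] with x' hx' hne
    apply gradY_eq_Rrep_of_diff hB0 hB1 hB2 hx' hy
    by_contra hnd
    apply hne
    apply (hB1.1 y hy).1 (subset_closure hx') (subset_closure hx)
    simp only [h0]
    unfold gradY gradient
    rw [fderiv_zero_of_not_differentiableAt hnd]; simp
  have hc1 : Tendsto (fun x' => gradY n c x' y) (𝓝[≠] x) (𝓝 (gradY n c x y)) :=
    (Dxy_equiv hB0 hB1 hx hy).1.continuousAt.tendsto.mono_left nhdsWithin_le_nhds
  have hR := (Rrep_contDiffOn hB0 hB1 hB2).2.continuousOn (x, y) ⟨hx, hy⟩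
  have hc2 : ContinuousAt (fun x' => Rrep n c (U ×ˢ closure V) (x', y)) x := by
    have : ContinuousWithinAt (fun x' => Rrep n c (U ×ˢ closure V) (x', y)) U x :=
      ContinuousWithinAt.comp (g := Rrep n c (U ×ˢ closure V)) (f := fun x' : Euc n => (x', y))
        hR (by fun_prop) (fun z hz => ⟨hz, hy⟩)
    exact this.continuousAt (hB0.1.mem_nhds hx)
  exact tendsto_nhds_unique (hc1.congr' hev) (hc2.tendsto.mono_left nhdsWithin_le_nhds)

lemma Dxy_eq_Rrep [Nontrivial (Euc n)] (hB0 : B0cond n c U V) (hB1 : B1cond n c U V)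
    (hB2 : B2cond n c U V) {x y : Euc n} (hx : x ∈ U) (hy : y ∈ closure V) :
    DxyC n c x y = (fderivWithin ℝ (Rrep n c (U ×ˢ closure V)) (U ×ˢ closure V) (x, y)).comp
      (ContinuousLinearMap.inl ℝ (Euc n) (Euc n)) := by
  obtain ⟨hS, hR⟩ := Rrep_contDiffOn hB0 hB1 hB2
  have h1 := ((hR (x, y) ⟨hx, hy⟩).differentiableWithinAt (by norm_num)).hasFDerivWithinAt
  have h2 : HasFDerivWithinAt (fun x' => Rrep n c (U ×ˢ closure V) (x', y))
      ((fderivWithin ℝ (Rrep n c (U ×ˢ closure V)) (U ×ˢ closure V) (x, y)).comp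
        (ContinuousLinearMap.inl ℝ (Euc n) (Euc n))) U x :=
    HasFDerivWithinAt.comp (g := Rrep n c (U ×ˢ closure V)) (f := fun x' : Euc n => (x', y)) x h1
      (hasFDerivAt_prodMk_left (𝕜 := ℝ) x y).hasFDerivWithinAt (fun z hz => ⟨hz, hy⟩)
  have h3 := h2.hasFDerivAt (hB0.1.mem_nhds hx)
  have h4 : (fun x' => gradY n c x' y) =ᶠ[𝓝 x] fun x' => Rrep n c (U ×ˢ closure V) (x', y) := by
    filter_upwards [hB0.1.mem_nhds hx] with x' hx'
    exact gradY_eq_Rrep hB0 hB1 hB2 hx' hy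
  exact (h3.congr_of_eventuallyEq h4).fderiv

lemma gradY_cont [Nontrivial (Euc n)] (hB0 : B0cond n c U V) (hB1 : B1cond n c U V)
    (hB2 : B2cond n c U V) {x : Euc n} (hx : x ∈ U) :
    ContinuousOn (fun y => gradY n c x y) (closure V) := by
  have hR := (Rrep_contDiffOn hB0 hB1 hB2).2.continuousOn
  have : ContinuousOn (fun y => Rrep n c (U ×ˢ closure V) (x, y)) (closure V) :=
    ContinuousOn.comp (g := Rrep n c (U ×ˢ closure V)) (f := fun y : Euc n => (x, y)) hR
      (by fun_prop) (fun z hz => ⟨hx, hz⟩)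
  exact this.congr fun y hy => gradY_eq_Rrep hB0 hB1 hB2 hx hy

lemma Dxy_cont [Nontrivial (Euc n)] (hB0 : B0cond n c U V) (hB1 : B1cond n c U V)
    (hB2 : B2cond n c U V) {x : Euc n} (hx : x ∈ U) :
    ContinuousOn (fun y => DxyC n c x y) (closure V) := by
  obtain ⟨hS, hR⟩ := Rrep_contDiffOn hB0 hB1 hB2
  have hR' : ContinuousOn (fderivWithin ℝ (Rrep n c (U ×ˢ closure V)) (U ×ˢ closure V))
    (U ×ˢ closure V) := hR.continuousOn_fderivWithin hS (by norm_num)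
  have h1 : ContinuousOn (fun y => fderivWithin ℝ (Rrep n c (U ×ˢ closure V)) (U ×ˢ closure V)
      (x, y)) (closure V) :=
    ContinuousOn.comp (f := fun y : Euc n => (x, y)) hR'
      (by fun_prop) (fun z hz => ⟨hx, hz⟩)
  have h2 := h1.clm_comp (continuousOn_const (c := ContinuousLinearMap.inl ℝ (Euc n) (Euc n)))
  exact h2.congr fun y hy => Dxy_eq_Rrep hB0 hB1 hB2 hx hy

lemma gradX_cont (hB1 : B1cond n c U V) {x : Euc n} (hx : x ∈ U) :
    ContinuousOn (fun y => gradX n c x y) (closure V) := by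
  have := (hB1.2 x (subset_closure hx)).2.1.continuousOn.neg
  refine this.congr fun y hy => ?_
  simp

lemma cost_cont (hB0 : B0cond n c U V) {x : Euc n} (hx : x ∈ closure U) :
    ContinuousOn (fun y => c x y) (closure V) :=
  ContinuousOn.comp (g := Function.uncurry c) (f := fun y : Euc n => (x, y))
    hB0.2.2.2.2.continuousOn (by fun_prop) (fun z hz => ⟨hx, hz⟩)

lemma vecC_cont [Nontrivial (Euc n)] (hB0 : B0cond n c U V) (hB1 : B1cond n c U V)
    (hB2 : B2cond n c U V) {x : Euc n} (hx : x ∈ U) :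
    ContinuousOn (fun p : Euc n × Euc n => vecC n c x p.1 p.2) (closure V ×ˢ closure V) := by
  have hinv : ContinuousOn (fun y => (DxyC n c x y).inverse) (closure V) := by
    intro y hy
    obtain ⟨-, A, hA, -⟩ := Dxy_equiv hB0 hB1 hx hy
    have h1 : ContinuousAt (ContinuousLinearMap.inverse (R := ℝ) (M := Euc n) (M₂ := Euc n))
        (DxyC n c x y) := by
      rw [hA]
      exact (contDiffAt_map_inverse (n := 1) A).continuousAt
    exact ContinuousAt.comp_continuousWithinAt (g := ContinuousLinearMap.inverse)
      (f := fun y => DxyC n c x y) h1 (Dxy_cont hB0 hB1 hB2 hx y hy)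
  have hadj : ContinuousOn (fun y => ContinuousLinearMap.adjoint (DxyC n c x y).inverse)
      (closure V) :=
    (ContinuousLinearMap.adjoint (𝕜 := ℝ) (E := Euc n) (F := Euc n)).continuous.comp_continuousOn
      hinv
  have hg := gradX_cont (V := V) hB1 hx
  have m1 : MapsTo (fun p : Euc n × Euc n => p.1) (closure V ×ˢ closure V) (closure V) :=
    fun p hp => hp.1
  have m2 : MapsTo (fun p : Euc n × Euc n => p.2) (closure V ×ˢ closure V) (closure V) :=
    fun p hp => hp.2
  exact (hadj.comp continuousOn_snd m2).clm_apply
    ((hg.comp continuousOn_fst m1).sub (hg.comp continuousOn_snd m2))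

lemma lip_cl [Nontrivial (Euc n)] (hB0 : B0cond n c U V) (hB1 : B1cond n c U V)
    (hB2 : B2cond n c U V)
    {bp bm D : ℝ} (hbp : ∀ x ∈ U, ∀ y ∈ V, ‖DxyC n c x y‖ ≤ bp)
    (hbm : ∀ x ∈ U, ∀ y ∈ V, ‖(DxyC n c x y).inverse‖ ≤ bm)
    (hD : ∀ x ∈ U, ∀ y ∈ V, ‖DxxyC n c x y‖ ≤ D) (h1 : 1 ≤ bp * bm)
    {x x' y ybar : Euc n} (hx : x ∈ U) (hx' : x' ∈ U) (hy : y ∈ closure V)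
    (hyb : ybar ∈ closure V) :
    ‖vecC n c x y ybar - vecC n c x' y ybar‖ ≤ (2 * bp ^ 4 * bm ^ 6 * D) *
      ‖-gradY n c x ybar - -gradY n c x' ybar‖ * ‖vecC n c x' y ybar‖ := by
  have hp : (y, ybar) ∈ closure (V ×ˢ V) := by rw [closure_prod_eq]; exact ⟨hy, hyb⟩
  have : (𝓝[V ×ˢ V] (y, ybar)).NeBot := mem_closure_iff_nhdsWithin_neBot.1 hp
  have hsub : V ×ˢ V ⊆ closure V ×ˢ closure V := prod_mono subset_closure subset_closure
  have hv : ∀ x ∈ U, ContinuousWithinAt (fun p : Euc n × Euc n => vecC n c x p.1 p.2) (V ×ˢ V)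
      (y, ybar) := fun x hx => (vecC_cont hB0 hB1 hB2 hx (y, ybar) ⟨hy, hyb⟩).mono hsub
  have hg : ∀ x ∈ U, ContinuousWithinAt (fun p : Euc n × Euc n => -gradY n c x p.2) (V ×ˢ V)
      (y, ybar) := by
    intro x hx
    have h1 : ContinuousOn (fun p : Euc n × Euc n => gradY n c x p.2) (closure V ×ˢ closure V) :=
      (gradY_cont hB0 hB1 hB2 hx).comp continuousOn_snd (fun p hp => hp.2)
    exact ((h1 (y, ybar) ⟨hy, hyb⟩).mono hsub).neg
  have t1 := ((hv x hx).sub (hv x' hx')).norm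
  have t2 := ((((hg x hx).sub (hg x' hx')).norm).const_mul (2 * bp ^ 4 * bm ^ 6 * D)).mul
    (hv x' hx').norm
  refine le_of_tendsto_of_tendsto t1.tendsto t2.tendsto ?_
  filter_upwards [self_mem_nhdsWithin] with p hp
  exact lip_int hB0 hB1 hB2 hbp hbm hD h1 hx hx' hp.1 hp.2

lemma qc_cl [Nontrivial (Euc n)] (hB0 : B0cond n c U V) (hB1 : B1cond n c U V)
    (hB2 : B2cond n c U V) (hB3 : B3cond n c U V) {x w y ybar : Euc n} (hx : x ∈ U) (hw : w ∈ U)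
    (hy : y ∈ closure V) (hyb : ybar ∈ closure V)
    (hpos : 0 < inner ℝ (vecC n c x y ybar) (-gradY n c w ybar - -gradY n c x ybar)) :
    -c x y + c x ybar ≤ -c w y + c w ybar := by
  have hp : (y, ybar) ∈ closure (V ×ˢ V) := by rw [closure_prod_eq]; exact ⟨hy, hyb⟩
  have : (𝓝[V ×ˢ V] (y, ybar)).NeBot := mem_closure_iff_nhdsWithin_neBot.1 hp
  have hsub : V ×ˢ V ⊆ closure V ×ˢ closure V := prod_mono subset_closure subset_closure
  have hv : ContinuousWithinAt (fun p : Euc n × Euc n => vecC n c x p.1 p.2) (V ×ˢ V)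
      (y, ybar) := (vecC_cont hB0 hB1 hB2 hx (y, ybar) ⟨hy, hyb⟩).mono hsub
  have hg : ∀ x ∈ U, ContinuousWithinAt (fun p : Euc n × Euc n => -gradY n c x p.2) (V ×ˢ V)
      (y, ybar) := by
    intro x hx
    have h1 : ContinuousOn (fun p : Euc n × Euc n => gradY n c x p.2) (closure V ×ˢ closure V) :=
      (gradY_cont hB0 hB1 hB2 hx).comp continuousOn_snd (fun p hp => hp.2)
    exact ((h1 (y, ybar) ⟨hy, hyb⟩).mono hsub).neg
  have hcc : ∀ x ∈ U, ContinuousWithinAt (fun p : Euc n × Euc n => -c x p.1 + c x p.2) (V ×ˢ V)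
      (y, ybar) := by
    intro x hx
    have hcx := cost_cont hB0 (subset_closure hx)
    have h1 : ContinuousOn (fun p : Euc n × Euc n => c x p.2) (closure V ×ˢ closure V) :=
      hcx.comp continuousOn_snd (fun p hp => hp.2)
    have h2 : ContinuousOn (fun p : Euc n × Euc n => c x p.1) (closure V ×ˢ closure V) :=
      hcx.comp continuousOn_fst (fun p hp => hp.1)
    exact ((h2.neg.add h1) (y, ybar) ⟨hy, hyb⟩).mono hsub
  have hin := (hv.inner (𝕜 := ℝ) ((hg w hw).sub (hg x hx))).tendsto
  refine le_of_tendsto_of_tendsto (hcc x hx).tendsto (hcc w hw).tendsto ?_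
  filter_upwards [self_mem_nhdsWithin, hin.eventually (lt_mem_nhds hpos)] with p hp hp2
  exact qc_int hB0 hB1 hB2 hB3 hx hw hp.1 hp.2 hp2

end P9

section P10
open Filter Topology

variable {n : ℕ} {c : Euc n → Euc n → ℝ} {U V : Set (Euc n)}

lemma cost_bdd (hB0 : B0cond n c U V) :
    ∃ M : ℝ, ∀ x ∈ closure U, ∀ y ∈ closure V, |c x y| ≤ M := by
  obtain ⟨-, hUb, -, hVb, hc⟩ := hB0
  have hK : IsCompact (closure U ×ˢ closure V) := hUb.isCompact_closure.prod hVb.isCompact_closure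
  obtain ⟨M, hM⟩ := hK.exists_bound_of_continuousOn hc.continuousOn
  exact ⟨M, fun x hx y hy => hM (x, y) ⟨hx, hy⟩⟩

lemma pot_bddBelow {u : Euc n → ℝ} {ybar : Euc n} {M : ℝ}
    (hM : ∀ x ∈ closure U, ∀ y ∈ closure V, |c x y| ≤ M)
    (hy : ybar ∈ closure V) (hu : CConvexOn n c (closure U) (closure V) u) :
    ∃ B : ℝ, ∀ x ∈ closure U, B ≤ u x := by
  by_cases hb : BddAbove ((fun x => -c x ybar - u x) '' closure U)
  · obtain ⟨T, hT⟩ := hb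
    refine ⟨-M - T, fun x hx => ?_⟩
    have h1 : -c x ybar - u x ≤ T := hT (mem_image_of_mem _ hx)
    have h2 := (abs_le.1 (hM x hx ybar hy)).2
    linarith
  · have h0 : ∀ y ∈ closure V, cStarT n c (closure U) u y = 0 := by
      intro y hyV
      apply Real.sSup_of_not_bddAbove
      rintro ⟨T, hT⟩
      apply hb
      refine ⟨T + 2 * M, ?_⟩
      rintro _ ⟨x, hx, rfl⟩
      have h1 : -c x y - u x ≤ T := hT (mem_image_of_mem _ hx)
      have h2 := abs_le.1 (hM x hx ybar hy)
      have h3 := abs_le.1 (hM x hx y hyV)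
      simp only
      linarith [h2.1, h3.2]
    refine ⟨-M, fun x hx => ?_⟩
    rw [hu x hx]
    have hmem : -c x ybar - cStarT n c (closure U) u ybar ∈
        (fun y => -c x y - cStarT n c (closure U) u y) '' closure V := mem_image_of_mem _ hy
    have hbd : BddAbove ((fun y => -c x y - cStarT n c (closure U) u y) '' closure V) := by
      refine ⟨M, ?_⟩
      rintro _ ⟨y, hyV, rfl⟩
      have h3 := abs_le.1 (hM x hx y hyV)
      simp only [h0 y hyV]
      linarith [h3.1]
    have := le_csSup hbd hmem
    rw [h0 ybar hy] at this
    have h3 := abs_le.1 (hM x hx ybar hy)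
    linarith [h3.2]

lemma sup_bound {f : Euc n × Euc n → ℝ} {S : Set (Euc n × Euc n)} (h : sSup (f '' S) ≠ 0) :
    ∀ p ∈ S, f p ≤ sSup (f '' S) := by
  intro p hp
  have hb : BddAbove (f '' S) := by
    by_contra hb
    exact h (Real.sSup_of_not_bddAbove hb)
  exact le_csSup hb (mem_image_of_mem _ hp)

lemma xOf_mem_cl {ybar q : Euc n} (hq : q ∈ clUy n c U ybar) : xOf n c U ybar q ∈ closure U :=
  Function.invFunOn_mem hq

lemma xOf_mem (hB1 : B1cond n c U V) {ybar q : Euc n} (hy : ybar ∈ closure V)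
    (hq : q ∈ Uyset n c U ybar) :
    xOf n c U ybar q ∈ U ∧ -gradY n c (xOf n c U ybar q) ybar = q := by
  obtain ⟨x, hx, rfl⟩ := hq
  simp only [xOf_left hB1 (subset_closure hx) hy]
  exact ⟨hx, trivial⟩

end P10

/-- Lemma 6.3: dual norm estimates. -/
theorem dual_norm_estimate (n : ℕ) (c : Euc n → Euc n → ℝ) (U V : Set (Euc n))
    (u : Euc n → ℝ) (ybar : Euc n) (K : Set (Euc n)) (L : Euc n →ᵃ[ℝ] Euc n)
    (hB0 : B0cond n c U V) (hB1 : B1cond n c U V) (hB2 : B2cond n c U V)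
    (hB3 : B3cond n c U V)
    (hy : ybar ∈ closure V)
    (hu : CConvexOn n c (closure U) (closure V) u)
    -- `𝒦` is an open convex subset of `Q = {ũ ≤ 0}`
    (hKopen : IsOpen K) (hKconv : Convex ℝ K)
    (hKQ : K ⊆ {q ∈ clUy n c U ybar | modPot n c U ybar u q ≤ 0})
    (hdiam : Metric.diam K ≤ epsC n c U V / 4)
    -- `𝒦 ⊂ B ⊂ 4·B ⊂ U_ȳ`
    (hball : ∃ z r, 0 < r ∧ K ⊆ Metric.ball z r ∧
      Metric.ball z (4 * r) ⊆ Uyset n c U ybar)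
    -- the John ellipsoid of `𝒦` is centered at the origin
    (hcenter : L 0 = 0)
    (hJohn1 : L '' Metric.closedBall 0 1 ⊆ K)
    (hJohn2 : K ⊆ L '' Metric.closedBall 0 (n : ℝ)) :
    ∀ ρ : ℝ, 0 < ρ → ρ < 1 →
      ∀ q ∈ ρ • K,
        ∀ y ∈ cSubdiffImg n (modCost n c U ybar) (clUy n c U ybar) (closure V)
          (modPot n c U ybar u) (ρ • K),
        dualNorm n K (-gradX n (modCost n c U ybar) q y) ≤
          8 * n / (1 - ρ) ^ 2 * |sInf (modPot n c U ybar u '' K)| := by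
  intro ρ hρ0 hρ1 q hq y hyS
  have hRHS : 0 ≤ 8 * (n : ℝ) / (1 - ρ) ^ 2 * |sInf (modPot n c U ybar u '' K)| := by positivity
  -- unpack the subdifferential
  obtain ⟨qt, hqt, hsub⟩ : ∃ qt ∈ ρ • K, (qt, y) ∈ cSubdiff n (modCost n c U ybar)
      (clUy n c U ybar) (closure V) (modPot n c U ybar u) := by
    simp only [cSubdiffImg, cSubdiffAt, mem_iUnion] at hyS
    obtain ⟨qt, hqt, h⟩ := hyS
    exact ⟨qt, hqt, h⟩
  obtain ⟨hqtU, hyV, heq⟩ := hsub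
  simp only at hqtU hyV heq
  rcases Nat.eq_zero_or_pos n with hn0 | hn
  · subst hn0
    refine Real.sSup_le ?_ hRHS
    rintro _ ⟨w, -, rfl⟩
    refine le_trans (le_of_eq ?_) hRHS
    have hw : w = 0 := Subsingleton.elim _ _
    simp [hw]
  by_cases hyy : y = ybar
  · subst hyy
    refine Real.sSup_le ?_ hRHS
    rintro _ ⟨w, -, rfl⟩
    refine le_trans (le_of_eq ?_) hRHS
    have hz : gradX n (modCost n c U y) q y = 0 := by
      unfold gradX gradient
      have : (fun x' => modCost n c U y x' y) = fun _ => (0 : ℝ) := by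
        ext1 x'; simp [modCost]
      rw [this]; simp
    simp [hz]
  have : Nonempty (Fin n) := ⟨⟨0, hn⟩⟩
  have hnt : Nontrivial (Euc n) := by
    refine ⟨⟨0, EuclideanSpace.single ⟨0, hn⟩ (1 : ℝ), fun h => ?_⟩⟩
    have := congrArg (fun v : Euc n => v ⟨0, hn⟩) h
    simp at this
  obtain ⟨z, r, hr, hKB, hBU⟩ := hball
  have hLlin : ∀ b, L b = L.linear b := by
    intro b
    have := congrFun L.decomp b
    simpa [hcenter] using this
  have hK0 : (0 : Euc n) ∈ K := hJohn1 ⟨0, by simp, hcenter⟩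
  have hKn : ∀ k ∈ K, -((n : ℝ)⁻¹ • k) ∈ K := by
    intro k hk
    obtain ⟨b, hb, rfl⟩ := hJohn2 hk
    apply hJohn1
    refine ⟨-((n : ℝ)⁻¹ • b), ?_, ?_⟩
    · rw [mem_closedBall_zero_iff] at hb ⊢
      rw [norm_neg, norm_smul, norm_inv, Real.norm_natCast]
      have : (0 : ℝ) < n := by exact_mod_cast hn
      rw [inv_mul_le_iff₀ this]
      linarith
    · rw [hLlin, hLlin, map_neg, map_smul]
  have hKbdd : IsBounded K := isBounded_ball.subset hKB
  -- positivity of the constant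
  have hdpos : 0 < Metric.diam K := by
    obtain ⟨k, hkne, hk⟩ : ∃ k : Euc n, k ≠ 0 ∧ k ∈ K := by
      have h1 : ∀ᶠ k in nhdsWithin (0 : Euc n) {0}ᶜ, k ∈ K :=
        nhdsWithin_le_nhds (hKopen.mem_nhds hK0)
      have h2 : ∀ᶠ k in nhdsWithin (0 : Euc n) {0}ᶜ, k ≠ 0 := self_mem_nhdsWithin
      obtain ⟨k, h3, h4⟩ := (h2.and h1).exists
      exact ⟨k, h3, h4⟩
    exact lt_of_lt_of_le (dist_pos.2 hkne) (dist_le_diam_of_mem hKbdd hk hK0)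
  have hεpos : 0 < epsC n c U V := by linarith
  have hprod : 0 < 2 * (betaPlus n c U V) ^ 4 * (betaMinus n c U V) ^ 6 * supDxxy n c U V :=
    inv_pos.1 hεpos
  have hbp0 : betaPlus n c U V ≠ 0 := by
    intro h; rw [h] at hprod; simp at hprod
  have hbm0 : betaMinus n c U V ≠ 0 := by
    intro h; rw [h] at hprod; simp at hprod
  have hD0 : supDxxy n c U V ≠ 0 := by
    intro h; rw [h] at hprod; simp at hprod
  have hbp : ∀ x ∈ U, ∀ y ∈ V, ‖DxyC n c x y‖ ≤ betaPlus n c U V := fun x hx y hy =>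
    sup_bound hbp0 (x, y) ⟨hx, hy⟩
  have hbm : ∀ x ∈ U, ∀ y ∈ V, ‖(DxyC n c x y).inverse‖ ≤ betaMinus n c U V := fun x hx y hy =>
    sup_bound hbm0 (x, y) ⟨hx, hy⟩
  have hD : ∀ x ∈ U, ∀ y ∈ V, ‖DxxyC n c x y‖ ≤ supDxxy n c U V := fun x hx y hy =>
    sup_bound hD0 (x, y) ⟨hx, hy⟩
  have hUy : ∀ p ∈ ball z (4 * r), xOf n c U ybar p ∈ U ∧
      -gradY n c (xOf n c U ybar p) ybar = p := fun p hp => xOf_mem hB1 hy (hBU hp)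
  have hball1 : ball z r ⊆ ball z (4 * r) := ball_subset_ball (by linarith)
  have h1 : 1 ≤ betaPlus n c U V * betaMinus n c U V := by
    obtain ⟨v, hv⟩ : V.Nonempty := closure_nonempty_iff.1 ⟨ybar, hy⟩
    have hx := (hUy 0 (hball1 (hKB hK0))).1
    set x := xOf n c U ybar 0
    obtain ⟨-, A, hA, hAi⟩ := Dxy_equiv hB0 hB1 hx (subset_closure hv)
    have hcomp : (DxyC n c x v).comp (DxyC n c x v).inverse = ContinuousLinearMap.id ℝ (Euc n) := by
      rw [hAi, hA]; ext1 w; simp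
    have h2 := ContinuousLinearMap.opNorm_comp_le (DxyC n c x v) (DxyC n c x v).inverse
    rw [hcomp, ContinuousLinearMap.norm_id] at h2
    exact h2.trans (mul_le_mul (hbp x hx v hv) (hbm x hx v hv) (norm_nonneg _)
      ((norm_nonneg _).trans (hbp x hx v hv)))
  -- bounds on the potential
  obtain ⟨M, hM⟩ := cost_bdd hB0
  obtain ⟨B, hB⟩ := pot_bddBelow hM hy hu
  have hstar : ∀ p ∈ clUy n c U ybar, -modCost n c U ybar p y - modPot n c U ybar u p ≤
      -modPot n c U ybar u qt - modCost n c U ybar qt y := by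
    intro p hp
    have hbd : BddAbove ((fun x => -modCost n c U ybar x y - modPot n c U ybar u x) ''
        clUy n c U ybar) := by
      refine ⟨M - B, ?_⟩
      rintro _ ⟨p, hp, rfl⟩
      have hx := xOf_mem_cl hp
      have h2 := (abs_le.1 (hM _ hx y hyV)).1
      have h3 := hB _ hx
      simp only [modCost, modPot]
      linarith
    have h2 := le_csSup hbd (mem_image_of_mem _ hp)
    have h3 : sSup ((fun x => -modCost n c U ybar x y - modPot n c U ybar u x) ''
        clUy n c U ybar) = cStarT n (modCost n c U ybar) (clUy n c U ybar)
          (modPot n c U ybar u) y := rfl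
    rw [h3] at h2
    linarith
  -- the supporting function
  obtain ⟨k, hk, rfl⟩ := hq
  obtain ⟨kt, hkt, rfl⟩ := hqt
  simp only at heq hstar hqtU ⊢
  set κ : ℝ := modCost n c U ybar (ρ • kt) y + modPot n c U ybar u (ρ • kt) with hκ
  have hρK : ∀ a ∈ K, ρ • a ∈ K := by
    intro a ha
    have := hKconv.add_smul_mem hK0 (by simpa using ha) (t := ρ) ⟨hρ0.le, hρ1.le⟩
    simpa using this
  have hgrad : ∀ p ∈ ball z (4 * r), HasFDerivAt (fun q => -c (xOf n c U ybar q) y +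
      c (xOf n c U ybar q) ybar) (InnerProductSpace.toDual ℝ (Euc n)
        (vecC n c (xOf n c U ybar p) y ybar)) p := by
    intro p hp
    have h2 := m_hasFDerivAt hB0 hB1 (hUy p hp).1 hyV hy
    rw [(hUy p hp).2] at h2
    exact h2
  have hgX : -gradX n (modCost n c U ybar) (ρ • k) y =
      vecC n c (xOf n c U ybar (ρ • k)) y ybar := by
    have h2 := (hgrad (ρ • k) (hball1 (hKB (hρK k hk)))).neg
    have h3 : HasFDerivAt (fun x' => modCost n c U ybar x' y)
        (-(InnerProductSpace.toDual ℝ (Euc n) (vecC n c (xOf n c U ybar (ρ • k)) y ybar)))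
        (ρ • k) := by
      refine h2.congr_of_eventuallyEq (Filter.Eventually.of_forall fun x' => ?_)
      simp only [modCost, Pi.neg_apply]; ring
    unfold gradX gradient
    rw [h3.fderiv, map_neg, neg_neg, LinearIsometryEquiv.symm_apply_apply]
  rw [hgX]
  refine Real.sSup_le ?_ hRHS
  rintro _ ⟨w, hw, rfl⟩
  refine geo_main (m := fun q => (-c (xOf n c U ybar q) y + c (xOf n c U ybar q) ybar) + κ)
    (v := fun p => vecC n c (xOf n c U ybar p) y ybar) (z := z) (r := r) (ε := epsC n c U V)
    hn hr hεpos ?_ ?_ ?_ ?_ hKB hdiam hKconv hK0 hKn hρ0 hρ1 ?_ hk hkt ?_ hw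
  · exact fun p hp => (hgrad p hp).add_const κ
  · intro p hp p' hp'
    have h2 := lip_cl hB0 hB1 hB2 hbp hbm hD h1 (hUy p hp).1 (hUy p' hp').1 hyV hy
    rw [(hUy p hp).2, (hUy p' hp').2] at h2
    have h3 : (epsC n c U V)⁻¹ =
      2 * (betaPlus n c U V) ^ 4 * (betaMinus n c U V) ^ 6 * supDxxy n c U V := inv_inv _
    rw [h3]; exact h2
  · exact fun p hp => vecC_ne_zero hB0 hB1 (hUy p hp).1 hyV hy hyy
  · intro p hp w hw hpos
    have h2 := qc_cl hB0 hB1 hB2 hB3 (hUy p hp).1 (hUy w hw).1 hyV hy (by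
      rw [(hUy p hp).2, (hUy w hw).2]; exact hpos)
    linarith
  · intro w hw
    have h2 := hstar w (hKQ hw).1
    have h3 := (hKQ hw).2
    simp only [hκ]
    simp only [modCost] at h2 ⊢
    linarith
  · have h2 : sInf (modPot n c U ybar u '' K) ≤ modPot n c U ybar u (ρ • kt) := by
      refine csInf_le ⟨B - M, ?_⟩ (mem_image_of_mem _ (hρK kt hkt))
      rintro _ ⟨p, hp, rfl⟩
      have hx := xOf_mem_cl (hKQ hp).1
      have h2 := (abs_le.1 (hM _ hx ybar hy)).1
      have h3 := hB _ hx
      simp only [modPot]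
      linarith
    have h3 := neg_abs_le (sInf (modPot n c U ybar u '' K))
    simp only [hκ, modCost]
    linarith
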